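/- arXiv:1209.1754 — 2 statements merged into one kernel-verified Lean document; each statement's English description precedes it below -/
import Mathlib

section
/- Let n ≥ 1 and let K be a simplicial complex in some Euclidean space with only finitely many faces, each face having at most n+1 vertices (so K has dimension at most n). Then there exist a topological embedding j of the underlying space |K| into ℝ^{2n+1}, a finite set Y ⊂ ℝ^{2n+1} such that for every point x ∈ ℝ^{2n+1} the set of points of Y at minimal distance from x is affinely independent (i.e. the Voronoi complex of Y is simple), and a subset S ⊆ Y, such that: the image j(|K|) is contained in the union U := ⋃_{y ∈ S} V_y of the Voronoi cells of the points of S, and the inclusion map j(|K|) ↪ U is a homotopy equivalence. -/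
open Geometry

/-- The set of points of a finite configuration `Y ⊆ ℝᵐ` nearest to `x`. -/
def nearestOf {m : ℕ} (Y : Finset (EuclideanSpace ℝ (Fin m)))
    (x : EuclideanSpace ℝ (Fin m)) : Set (EuclideanSpace ℝ (Fin m)) :=
  {p | p ∈ Y ∧ ∀ q ∈ Y, dist x p ≤ dist x q}

/-- The union of the Voronoi cells (with respect to the configuration `Y`) of the points
of `S ⊆ Y`. -/
def voronoiUnion {m : ℕ} (Y S : Finset (EuclideanSpace ℝ (Fin m))) :
    Set (EuclideanSpace ℝ (Fin m)) :=
  {x | ∃ p ∈ S, ∀ q ∈ Y, dist x p ≤ dist x q}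

section GeneralPosition

variable {E : Type*} [NormedAddCommGroup E] [InnerProductSpace ℝ E]

/-- Two points that are both equidistant to a family which affinely spans the space coincide. -/
theorem eq_of_equidistant_of_vectorSpan_eq_top {κ : Type*} {y : κ → E}
    (hy : vectorSpan ℝ (Set.range y) = ⊤) {a b : E} {r t : ℝ}
    (ha : ∀ i, dist a (y i) = r) (hb : ∀ i, dist b (y i) = t) : a = b := by
  have key : ∀ v ∈ vectorSpan ℝ (Set.range y), inner ℝ (a - b) v = 0 := by
    intro v hv
    rw [vectorSpan] at hv
    induction hv using Submodule.span_induction with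
    | mem x hx =>
      obtain ⟨_, ⟨i, rfl⟩, _, ⟨k, rfl⟩, rfl⟩ := hx
      have h1 : ‖a - y i‖ ^ 2 = ‖a - y k‖ ^ 2 := by
        rw [← dist_eq_norm, ← dist_eq_norm, ha, ha]
      have h2 : ‖b - y i‖ ^ 2 = ‖b - y k‖ ^ 2 := by
        rw [← dist_eq_norm, ← dist_eq_norm, hb, hb]
      simp only [norm_sub_sq_real] at h1 h2
      simp only [vsub_eq_sub, inner_sub_left, inner_sub_right]
      linarith
    | zero => simp
    | add x z _ _ hx hz => rw [inner_add_right, hx, hz, add_zero]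
    | smul c x _ hx => rw [inner_smul_right, hx, mul_zero]
  have := key (a - b) (hy ▸ Submodule.mem_top)
  rwa [inner_self_eq_zero, sub_eq_zero] at this

/-- A finite family of points is in general position on a set of indices if subfamilies with at most
`dim + 1` members are affinely independent and no `dim + 2` members lie on a sphere. -/
def GeneralPositionOn {κ : Type*} (y : κ → E) (s : Set κ) : Prop :=
  (∀ T : Finset κ, (T : Set κ) ⊆ s → T.card ≤ Module.finrank ℝ E + 1 →
    AffineIndependent ℝ (fun i : T => y i)) ∧
  ∀ T : Finset κ, (T : Set κ) ⊆ s → ∀ (x : E) (r : ℝ), (∀ i ∈ T, dist x (y i) = r) →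
    T.card ≤ Module.finrank ℝ E + 1

theorem exists_mem_ball_avoiding [FiniteDimensional ℝ E] [Nontrivial E] {κ : Type*} [DecidableEq κ]
    (s : Finset κ) (y : κ → E) (hy : GeneralPositionOn y (s : Set κ)) (x₀ : E) {ε : ℝ}
    (hε : 0 < ε) :
    ∃ q ∈ Metric.ball x₀ ε,
      (∀ T ⊆ s, T.card ≤ Module.finrank ℝ E → q ∉ affineSpan ℝ (y '' (T : Set κ))) ∧
      (∀ T ⊆ s, T.card = Module.finrank ℝ E + 1 → ∀ (x : E) (r : ℝ),
        (∀ i ∈ T, dist x (y i) = r) → dist x q ≠ r) := by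
  classical
  borelize E
  let μ : MeasureTheory.Measure E := MeasureTheory.Measure.addHaar
  let bad₁ : Finset κ → Set E := fun T =>
    {q | T.card ≤ Module.finrank ℝ E ∧ q ∈ affineSpan ℝ (y '' (T : Set κ))}
  let bad₂ : Finset κ → Set E := fun T =>
    {q | T.card = Module.finrank ℝ E + 1 ∧ ∃ (x : E) (r : ℝ),
        (∀ i ∈ T, dist x (y i) = r) ∧ dist x q = r}
  have h₁ : ∀ T ∈ s.powerset, μ (bad₁ T) = 0 := by
    intro T _
    by_cases hT : T.card ≤ Module.finrank ℝ E
    · refine MeasureTheory.measure_mono_null (fun q hq => hq.2)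
        (MeasureTheory.Measure.addHaar_affineSubspace μ (affineSpan ℝ (y '' (T : Set κ))) ?_)
      intro htop
      rcases T.eq_empty_or_nonempty with rfl | hne
      · simp at htop
      · have h1 : vectorSpan ℝ (y '' (T : Set κ)) = ⊤ := by
          rw [← direction_affineSpan, htop, AffineSubspace.direction_top]
        have h2 := finrank_vectorSpan_image_finset_le ℝ y T (n := T.card - 1)
          (by have := hne.card_pos; omega)
        rw [Finset.coe_image, h1, finrank_top] at h2
        have := hne.card_pos
        omega
    · convert! MeasureTheory.measure_empty (μ := μ)
      ext q
      simp [bad₁, hT]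
  have h₂ : ∀ T ∈ s.powerset, μ (bad₂ T) = 0 := by
    intro T hTs
    rw [Finset.mem_powerset] at hTs
    by_cases hT : T.card = Module.finrank ℝ E + 1
    · by_cases hex : ∃ (x : E) (r : ℝ), ∀ i ∈ T, dist x (y i) = r
      · obtain ⟨x, r, hx⟩ := hex
        refine MeasureTheory.measure_mono_null ?_
          (MeasureTheory.Measure.addHaar_sphere μ x r)
        rintro q ⟨_, x', r', hx', hq⟩
        have hind := hy.1 T (by exact_mod_cast hTs) hT.le
        have hspan : vectorSpan ℝ (Set.range fun i : T => y i) = ⊤ :=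
          hind.vectorSpan_eq_top_of_card_eq_finrank_add_one (by simpa using hT)
        have hxx : x = x' := eq_of_equidistant_of_vectorSpan_eq_top hspan
          (fun i => hx i i.2) (fun i => hx' i i.2)
        have hne : T.Nonempty := Finset.card_pos.1 (by omega)
        obtain ⟨i, hi⟩ := hne
        have : r = r' := by rw [← hx i hi, ← hx' i hi, hxx]
        subst hxx this
        rw [Metric.mem_sphere, dist_comm, hq]
      · convert! MeasureTheory.measure_empty (μ := μ)
        ext q
        simp only [bad₂, Set.mem_ofPred_eq, Set.mem_empty_iff_false, iff_false]
        rintro ⟨_, x, r, hx, _⟩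
        exact hex ⟨x, r, hx⟩
    · convert! MeasureTheory.measure_empty (μ := μ)
      ext q
      simp [bad₂, hT]
  have hnull : μ (⋃ T ∈ s.powerset, (bad₁ T ∪ bad₂ T)) = 0 := by
    refine (MeasureTheory.measure_biUnion_null_iff s.powerset.countable_toSet).2 fun T hT => ?_
    exact MeasureTheory.measure_union_null (h₁ T hT) (h₂ T hT)
  have hball : 0 < μ (Metric.ball x₀ ε) := Metric.measure_ball_pos μ x₀ hε
  have hnot : ¬ Metric.ball x₀ ε ⊆ ⋃ T ∈ s.powerset, (bad₁ T ∪ bad₂ T) := fun hsub =>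
    hball.ne' (MeasureTheory.measure_mono_null hsub hnull)
  obtain ⟨q, hq, hq'⟩ := Set.not_subset.1 hnot
  simp only [Set.mem_iUnion, not_exists, Set.mem_union, not_or, Finset.mem_powerset] at hq'
  refine ⟨q, hq, fun T hT hc hmem => (hq' T hT).1 ⟨hc, hmem⟩, fun T hT hc x r hx hxq =>
    (hq' T hT).2 ⟨hc, x, r, hx, hxq⟩⟩

theorem GeneralPositionOn.insert_update {κ : Type*} [DecidableEq κ] {s : Finset κ} {y : κ → E}
    (hy : GeneralPositionOn y (s : Set κ)) {a : κ} (ha : a ∉ s) {q : E}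
    (h₁ : ∀ T ⊆ s, T.card ≤ Module.finrank ℝ E → q ∉ affineSpan ℝ (y '' (T : Set κ)))
    (h₂ : ∀ T ⊆ s, T.card = Module.finrank ℝ E + 1 → ∀ (x : E) (r : ℝ),
        (∀ i ∈ T, dist x (y i) = r) → dist x q ≠ r) :
    GeneralPositionOn (Function.update y a q) (insert a s : Finset κ) := by
  have hupd : ∀ T ⊆ s, ∀ i ∈ T, Function.update y a q i = y i := fun T hT i hi =>
    Function.update_of_ne (ne_of_mem_of_not_mem (hT hi) ha) _ _
  constructor
  · intro T hT hc
    have hT' : T ⊆ insert a s := by exact_mod_cast hT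
    by_cases haT : a ∈ T
    · have hsub : T.erase a ⊆ s := by
        intro i hi
        rw [Finset.mem_erase] at hi
        exact (Finset.mem_insert.1 (hT' hi.2)).resolve_left hi.1
      have hcard : (T.erase a).card ≤ Module.finrank ℝ E := by
        rw [Finset.card_erase_of_mem haT]; omega
      refine AffineIndependent.affineIndependent_of_notMem_span (i := ⟨a, haT⟩) ?_ ?_
      · have hI := hy.1 (T.erase a) (by exact_mod_cast hsub) (hcard.trans (Nat.le_succ _))
        let e : {x : T // x ≠ ⟨a, haT⟩} ↪ (T.erase a : Finset κ) :=
          ⟨fun x => ⟨x.1.1, Finset.mem_erase.2 ⟨fun h => x.2 (Subtype.ext h), x.1.2⟩⟩,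
            fun x z h => by
              apply Subtype.ext; apply Subtype.ext; simpa using h⟩
        convert! hI.comp_embedding e using 1
        funext x
        exact hupd _ hsub _ (e x).2
      · have hq := h₁ _ hsub hcard
        simp only [Function.update_self]
        convert! hq using 3
        ext z
        constructor
        · rintro ⟨i, hi, rfl⟩
          have hi' : i.1 ∈ T.erase a :=
            Finset.mem_erase.2 ⟨fun h => hi (Subtype.ext h), i.2⟩
          exact ⟨i.1, hi', (hupd _ hsub _ hi').symm⟩
        · rintro ⟨i, hi, rfl⟩
          have hi' := Finset.mem_erase.1 (Finset.mem_coe.1 hi)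
          exact ⟨⟨i, hi'.2⟩, fun h => hi'.1 (congrArg Subtype.val h), hupd _ hsub _ hi⟩
    · have hsub : T ⊆ s := fun i hi =>
        (Finset.mem_insert.1 (hT' hi)).resolve_left (ne_of_mem_of_not_mem hi haT)
      have := hy.1 T (by exact_mod_cast hsub) hc
      convert! this using 1
      funext i
      exact hupd T hsub i i.2
  · intro T hT x r hx
    have hT' : T ⊆ insert a s := by exact_mod_cast hT
    by_cases haT : a ∈ T
    · have hsub : T.erase a ⊆ s := by
        intro i hi
        rw [Finset.mem_erase] at hi
        exact (Finset.mem_insert.1 (hT' hi.2)).resolve_left hi.1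
      have hx' : ∀ i ∈ T.erase a, dist x (y i) = r := fun i hi => by
        rw [← hupd _ hsub i hi]; exact hx i (Finset.mem_of_mem_erase hi)
      have hcle := hy.2 _ (by exact_mod_cast hsub) x r hx'
      have hne : (T.erase a).card ≠ Module.finrank ℝ E + 1 := fun hc =>
        h₂ _ hsub hc x r hx' (by simpa using hx a haT)
      rw [Finset.card_erase_of_mem haT] at hcle hne
      omega
    · have hsub : T ⊆ s := fun i hi =>
        (Finset.mem_insert.1 (hT' hi)).resolve_left (ne_of_mem_of_not_mem hi haT)
      exact hy.2 T (by exact_mod_cast hsub) x r fun i hi => by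
        rw [← hupd _ hsub i hi]; exact hx i hi

/-- Families in general position are dense among finite families of points. -/
theorem exists_generalPositionOn_near [FiniteDimensional ℝ E] [Nontrivial E] {κ : Type*} [Finite κ]
    (y : κ → E) {ε : ℝ} (hε : 0 < ε) :
    ∃ y' : κ → E, (∀ i, dist (y' i) (y i) < ε) ∧ GeneralPositionOn y' Set.univ := by
  classical
  cases nonempty_fintype κ
  suffices h : ∀ s : Finset κ, ∃ y' : κ → E, (∀ i, dist (y' i) (y i) < ε) ∧
      GeneralPositionOn y' (s : Set κ) by
    simpa using h Finset.univ
  intro s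
  induction s using Finset.induction_on with
  | empty =>
    refine ⟨y, fun i => by simpa using hε, fun T hT _ => ?_, fun T hT x r _ => ?_⟩
    · have : T = ∅ := by simpa using hT
      subst this
      exact affineIndependent_of_subsingleton ℝ _
    · have : T = ∅ := by simpa using hT
      simp [this]
  | insert a s ha ih =>
    obtain ⟨y', hd, hg⟩ := ih
    obtain ⟨q, hq, h₁, h₂⟩ := exists_mem_ball_avoiding s y' hg (y a) hε
    refine ⟨Function.update y' a q, fun i => ?_, hg.insert_update ha h₁ h₂⟩
    rcases eq_or_ne i a with rfl | hi
    · simpa using hq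
    · rw [Function.update_of_ne hi]; exact hd i

end GeneralPosition

section Neighborly

open Filter Topology

/-- The power of the centroid of the points indexed by `σ`, after rescaling, for points whose
heights are consecutive powers of `H`. -/
noncomputable def rescaledPower {N : ℕ} (k : Fin N) (L : Fin N → ℝ) (c Q : ℝ) (σ : Finset (Fin N))
    (H : ℝ) : ℝ :=
  ((∑ i ∈ σ, H ^ (i.val + 1)) / σ.card / H ^ (k.val + 1)) ^ 2
    - 2 * c * ((∑ i ∈ σ, H ^ (i.val + 1)) / σ.card / H ^ (k.val + 1))
    + (∑ i ∈ σ, L i) / σ.card + Q / H ^ (2 * (k.val + 1))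

theorem tendsto_pow_div_pow_of_le {i k : ℕ} (h : i ≤ k) :
    Tendsto (fun H : ℝ => H ^ (i + 1) / H ^ (k + 1)) atTop (𝓝 (if i = k then 1 else 0)) := by
  rcases h.eq_or_lt with rfl | h
  · simp only [if_true]
    refine tendsto_const_nhds.congr' ?_
    filter_upwards [eventually_gt_atTop 0] with H hH
    rw [div_self (by positivity)]
  · rw [if_neg h.ne]
    exact tendsto_pow_div_pow_atTop_zero (by omega)

theorem tendsto_const_div_pow_atTop (Q : ℝ) (k : ℕ) :
    Tendsto (fun H : ℝ => Q / H ^ (2 * (k + 1))) atTop (𝓝 0) :=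
  tendsto_const_nhds.div_atTop (tendsto_pow_atTop (by omega))

theorem tendsto_rescaledPower {N : ℕ} (k : Fin N) (L : Fin N → ℝ) (c Q : ℝ) (σ : Finset (Fin N))
    (hσ : ∀ i ∈ σ, i ≤ k) :
    Tendsto (rescaledPower k L c Q σ) atTop
      (𝓝 (((if k ∈ σ then 1 else 0) / σ.card) ^ 2 - 2 * c * ((if k ∈ σ then 1 else 0) / σ.card)
        + (∑ i ∈ σ, L i) / σ.card)) := by
  have hu : Tendsto (fun H : ℝ => (∑ i ∈ σ, H ^ (i.val + 1)) / σ.card / H ^ (k.val + 1)) atTop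
      (𝓝 ((if k ∈ σ then 1 else 0) / σ.card)) := by
    have h1 : Tendsto (fun H : ℝ => (∑ i ∈ σ, H ^ (i.val + 1) / H ^ (k.val + 1)) / σ.card) atTop
        (𝓝 ((∑ i ∈ σ, if i.val = k.val then (1 : ℝ) else 0) / σ.card)) :=
      (tendsto_finsetSum σ fun i hi => tendsto_pow_div_pow_of_le (hσ i hi)).div_const _
    have h2 : (∑ i ∈ σ, if i.val = k.val then (1 : ℝ) else 0) = if k ∈ σ then 1 else 0 := by
      simp [← Fin.ext_iff]
    rw [h2] at h1
    refine h1.congr fun H => ?_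
    rw [← Finset.sum_div]
    ring
  have := (((hu.pow 2).sub (hu.const_mul (2 * c))).add_const ((∑ i ∈ σ, L i) / σ.card)).add
    (tendsto_const_div_pow_atTop Q k)
  rw [add_zero] at this
  exact this

theorem eventually_lt_rescaledPower {N : ℕ} (k : Fin N) (L : Fin N → ℝ) (c Q : ℝ)
    (σ : Finset (Fin N)) (hc : 2 * c = 1 + L k) (hL : ∀ i, 0 ≤ L i) (hQ : 0 ≤ Q)
    (hσ : ∃ i ∈ σ, i ≠ k ∧ 1 ≤ L i) :
    ∃ ε > 0, ∀ᶠ H in atTop, ε < rescaledPower k L c Q σ H := by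
  obtain ⟨i, hi, hik, hLi⟩ := hσ
  have hm : (0 : ℝ) < σ.card := by exact_mod_cast Finset.card_pos.2 ⟨i, hi⟩
  by_cases htop : ∀ j ∈ σ, j ≤ k
  · suffices h : 0 < ((if k ∈ σ then 1 else 0) / σ.card : ℝ) ^ 2 -
        2 * c * ((if k ∈ σ then 1 else 0) / σ.card) + (∑ i ∈ σ, L i) / σ.card from
      ⟨_, half_pos h, (tendsto_rescaledPower k L c Q σ htop).eventually_const_lt (half_lt_self h)⟩
    by_cases hk : k ∈ σ
    · have hsum : L k + 1 ≤ ∑ i ∈ σ, L i := by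
        rw [← Finset.add_sum_erase σ L hk]
        have := Finset.single_le_sum (f := L) (fun j _ => hL j) (Finset.mem_erase.2 ⟨hik, hi⟩)
        linarith
      have h1 : (L k + 1) / σ.card ≤ (∑ i ∈ σ, L i) / σ.card := by gcongr
      have h2 : 0 < (1 / σ.card : ℝ) ^ 2 := by positivity
      rw [if_pos hk, hc]
      have h3 : (1 + L k) * (1 / σ.card) = (L k + 1) / (σ.card : ℝ) := by ring
      rw [h3]
      linarith
    · have hsum : 1 ≤ ∑ i ∈ σ, L i :=
        hLi.trans (Finset.single_le_sum (f := L) (fun j _ => hL j) hi)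
      have : 0 < (∑ i ∈ σ, L i) / σ.card := by positivity
      simpa [hk] using this
  · push Not at htop
    obtain ⟨j, hj, hjk⟩ := htop
    refine ⟨1 / 2, by norm_num, ?_⟩
    filter_upwards [eventually_ge_atTop (σ.card * (2 * |c| + 1)), eventually_ge_atTop 1] with H h1 h2
    have hH : 0 < H := by linarith
    have hu : H / σ.card ≤ (∑ i ∈ σ, H ^ (i.val + 1)) / σ.card / H ^ (k.val + 1) := by
      rw [div_right_comm]
      gcongr
      rw [le_div_iff₀ (by positivity)]
      calc H * H ^ (k.val + 1) = H ^ (k.val + 2) := by ring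
        _ ≤ H ^ (j.val + 1) := pow_le_pow_right₀ h2 (by have : k.val < j.val := hjk; omega)
        _ ≤ _ := Finset.single_le_sum (f := fun i : Fin N => H ^ (i.val + 1))
            (fun _ _ => by positivity) hj
    have hu' : 2 * |c| + 1 ≤ H / σ.card := by
      rw [le_div_iff₀ hm]; linarith
    unfold rescaledPower
    set u := (∑ i ∈ σ, H ^ (i.val + 1)) / σ.card / H ^ (k.val + 1)
    have h3 : 0 ≤ (∑ i ∈ σ, L i) / σ.card := div_nonneg (Finset.sum_nonneg fun j _ => hL j) hm.le
    have h4 : 0 ≤ Q / H ^ (2 * (k.val + 1)) := by positivity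
    have h5 := le_abs_self c
    have h6 := abs_nonneg c
    nlinarith

theorem rescaledPower_singleton_tendsto_zero {N : ℕ} (k : Fin N) (L : Fin N → ℝ) (c Q : ℝ)
    (hc : 2 * c = 1 + L k) {j : Fin N} (hj : j = k ∨ (j < k ∧ L j = 0)) :
    Tendsto (rescaledPower k L c Q {j}) atTop (𝓝 0) := by
  convert! tendsto_rescaledPower k L c Q {j} ?_ using 2
  · rcases hj with rfl | ⟨hj, hL⟩
    · simp [hc]
    · simp [hj.ne', hL]
  · rcases hj with rfl | ⟨hj, hL⟩
    · simp
    · simp [hj.le]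

/-- The point of the `(2n+1)`-dimensional space at height `H ^ (i+1)` over the point with parameter
`i` of the moment curve. -/
noncomputable def tallMomentPoint (n : ℕ) (H : ℝ) (i : ℕ) : EuclideanSpace ℝ (Fin (2 * n + 1)) :=
  WithLp.toLp 2 (Fin.cons (H ^ (i + 1)) fun e : Fin (2 * n) => (i : ℝ) ^ (e.val + 1))

theorem dist_lt_dist_iff_power {E : Type*} [NormedAddCommGroup E] [InnerProductSpace ℝ E]
    (p a b : E) :
    dist p a < dist p b ↔ ‖a‖ ^ 2 - 2 * inner ℝ p a < ‖b‖ ^ 2 - 2 * inner ℝ p b := by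
  rw [← sq_lt_sq₀ dist_nonneg dist_nonneg, dist_eq_norm, dist_eq_norm, norm_sub_sq_real,
    norm_sub_sq_real]
  constructor <;> intro h <;> linarith

theorem power_centroid_tallMomentPoint (n N : ℕ) {H : ℝ} (hH : 0 < H) (k : Fin N) (c : ℝ)
    (P : Polynomial ℝ) (hP : P.natDegree ≤ 2 * n) (σ : Finset (Fin N)) (hσ : σ.Nonempty)
    (p : EuclideanSpace ℝ (Fin (2 * n + 1)))
    (hp : p = WithLp.toLp 2 (Fin.cons (c * H ^ (k.val + 1)) fun e : Fin (2 * n) =>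
      -(1 / 2) * H ^ (2 * (k.val + 1)) * P.coeff (e.val + 1)))
    (b : EuclideanSpace ℝ (Fin (2 * n + 1)))
    (hb : b = (σ.card : ℝ)⁻¹ • ∑ i ∈ σ, tallMomentPoint n H i) :
    ‖b‖ ^ 2 - 2 * inner ℝ p b = H ^ (2 * (k.val + 1)) *
      (rescaledPower k (fun i => P.eval (i : ℝ)) c
        (∑ e : Fin (2 * n), ((∑ i ∈ σ, (i : ℝ) ^ (e.val + 1)) / σ.card) ^ 2) σ H - P.coeff 0) := by
  have hm : (σ.card : ℝ) ≠ 0 := by exact_mod_cast hσ.card_pos.ne'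
  have hb0 : b 0 = (∑ i ∈ σ, H ^ (i.val + 1)) / σ.card := by
    simp [hb, tallMomentPoint, div_eq_inv_mul]
  have hbe : ∀ e : Fin (2 * n), b e.succ = (∑ i ∈ σ, (i : ℝ) ^ (e.val + 1)) / σ.card := by
    intro e
    simp [hb, tallMomentPoint, div_eq_inv_mul]
  have heval : (∑ i ∈ σ, P.eval (i : ℝ)) / σ.card =
      P.coeff 0 + ∑ e : Fin (2 * n), P.coeff (e.val + 1) *
        ((∑ i ∈ σ, (i : ℝ) ^ (e.val + 1)) / σ.card) := by
    have h1 : ∀ i : Fin N, P.eval (i : ℝ) =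
        P.coeff 0 + ∑ e : Fin (2 * n), P.coeff (e.val + 1) * (i : ℝ) ^ (e.val + 1) := by
      intro i
      rw [Polynomial.eval_eq_sum_range' (Nat.lt_succ_of_le hP), Finset.sum_range_succ',
        Finset.sum_range, add_comm]
      simp
    simp_rw [h1]
    rw [Finset.sum_add_distrib, Finset.sum_const, nsmul_eq_mul, Finset.sum_comm, add_div,
      mul_div_cancel_left₀ _ hm, Finset.sum_div]
    congr 1
    refine Finset.sum_congr rfl fun e _ => ?_
    rw [← Finset.mul_sum, mul_div_assoc]
  rw [EuclideanSpace.norm_sq_eq, PiLp.inner_apply]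
  simp only [Fin.sum_univ_succ, hb0, hbe, rescaledPower, heval, Real.norm_eq_abs, sq_abs]
  have hp0 : p 0 = c * H ^ (k.val + 1) := by simp [hp]
  have hpe : ∀ e : Fin (2 * n), p e.succ =
      -(1 / 2) * H ^ (2 * (k.val + 1)) * P.coeff (e.val + 1) := by
    intro e; simp [hp]
  simp only [hp0, hpe, RCLike.inner_apply, conj_trivial]
  have h2 : ∀ x : Fin (2 * n) → ℝ, ∑ e : Fin (2 * n), x e *
      (-(1 / 2) * H ^ (2 * (k.val + 1)) * P.coeff (e.val + 1)) =
      -(1 / 2) * H ^ (2 * (k.val + 1)) * ∑ e : Fin (2 * n), P.coeff (e.val + 1) * x e := by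
    intro x
    rw [Finset.mul_sum]
    exact Finset.sum_congr rfl fun e _ => by ring
  rw [h2, pow_mul', pow_two (H ^ (k.val + 1))]
  have hK : H ^ (k.val + 1) ≠ 0 := by positivity
  set T := H ^ (k.val + 1)
  field_simp
  ring

/-- Euclidean spaces of dimension `2n+1` contain arbitrarily large finite families of points such
that any at most `n+1` of them can be strictly separated by a sphere from the centroids of all
subfamilies which are not contained in them. -/
theorem exists_neighborly_family (n N : ℕ) :
    ∃ s : Fin N → EuclideanSpace ℝ (Fin (2 * n + 1)), ∀ τ : Finset (Fin N), τ.Nonempty →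
      τ.card ≤ n + 1 → ∃ p, ∀ j ∈ τ, ∀ σ : Finset (Fin N), σ.Nonempty → ¬ σ ⊆ τ →
        dist p (s j) < dist p ((σ.card : ℝ)⁻¹ • ∑ i ∈ σ, s i) := by
  suffices h : ∀ τ : Finset (Fin N), τ.Nonempty → τ.card ≤ n + 1 → ∀ᶠ H : ℝ in atTop, ∃ p,
      ∀ j ∈ τ, ∀ σ : Finset (Fin N), σ.Nonempty → ¬ σ ⊆ τ →
        dist p (tallMomentPoint n H j) <
          dist p ((σ.card : ℝ)⁻¹ • ∑ i ∈ σ, tallMomentPoint n H i) by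
    have h' : ∀ᶠ H : ℝ in atTop, ∀ τ : Finset (Fin N), τ.Nonempty → τ.card ≤ n + 1 → ∃ p,
        ∀ j ∈ τ, ∀ σ : Finset (Fin N), σ.Nonempty → ¬ σ ⊆ τ →
        dist p (tallMomentPoint n H j) <
          dist p ((σ.card : ℝ)⁻¹ • ∑ i ∈ σ, tallMomentPoint n H i) := by
      simp only [eventually_all]
      exact h
    obtain ⟨H, hH⟩ := h'.exists
    exact ⟨fun i => tallMomentPoint n H i, hH⟩
  intro τ hτ hcard
  set k := τ.max' hτ with hk
  have hkτ : k ∈ τ := τ.max'_mem hτ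
  let P : Polynomial ℝ := ∏ j ∈ τ.erase k, (Polynomial.X - Polynomial.C (j : ℝ)) ^ 2
  have hP : P.natDegree ≤ 2 * n := by
    have h1 : P.natDegree ≤ ∑ j ∈ τ.erase k, 2 := by
      refine (Polynomial.natDegree_prod_le _ _).trans (Finset.sum_le_sum fun j _ => ?_)
      refine Polynomial.natDegree_pow_le.trans ?_
      rw [Polynomial.natDegree_X_sub_C]
    rw [Finset.sum_const, Finset.card_erase_of_mem hkτ, smul_eq_mul] at h1
    omega
  have heval : ∀ i : Fin N, P.eval (i : ℝ) = ((∏ j ∈ τ.erase k, ((i : ℤ) - j) ^ 2 : ℤ) : ℝ) := by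
    intro i
    simp [P, Polynomial.eval_prod]
  have hL0 : ∀ i : Fin N, 0 ≤ P.eval (i : ℝ) := by
    intro i
    rw [heval]
    exact_mod_cast Finset.prod_nonneg fun j _ => sq_nonneg _
  have hLz : ∀ i ∈ τ, i ≠ k → P.eval (i : ℝ) = 0 := by
    intro i hi hik
    rw [heval, Finset.prod_eq_zero (Finset.mem_erase.2 ⟨hik, hi⟩) (by simp)]
    simp
  have hL1 : ∀ i ∉ τ, 1 ≤ P.eval (i : ℝ) := by
    intro i hi
    rw [heval]
    have : 0 < ∏ j ∈ τ.erase k, ((i : ℤ) - j) ^ 2 := by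
      refine Finset.prod_pos fun j hj => ?_
      have hij : i ≠ j := fun h => hi (h ▸ Finset.mem_of_mem_erase hj)
      have : (i : ℤ) - j ≠ 0 := by
        rw [sub_ne_zero]
        exact_mod_cast fun h => hij (Fin.ext h)
      positivity
    exact_mod_cast this
  let c : ℝ := (1 + P.eval (k : ℝ)) / 2
  have hc : 2 * c = 1 + P.eval (k : ℝ) := by simp only [c]; ring
  let Q : Finset (Fin N) → ℝ := fun σ =>
    ∑ e : Fin (2 * n), ((∑ i ∈ σ, (i : ℝ) ^ (e.val + 1)) / σ.card) ^ 2
  have hQ : ∀ σ, 0 ≤ Q σ := fun σ => Finset.sum_nonneg fun _ _ => sq_nonneg _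
  have key : ∀ᶠ H : ℝ in atTop, ∀ j ∈ τ, ∀ σ : Finset (Fin N), σ.Nonempty → ¬ σ ⊆ τ →
      rescaledPower k (fun i => P.eval (i : ℝ)) c (Q {j}) {j} H <
        rescaledPower k (fun i => P.eval (i : ℝ)) c (Q σ) σ H := by
    simp only [eventually_all]
    intro j hj σ _ hστ
    obtain ⟨i, hi, hiτ⟩ := Finset.not_subset.1 hστ
    obtain ⟨ε, hε, hev⟩ := eventually_lt_rescaledPower k (fun i => P.eval (i : ℝ)) c (Q σ) σ hc hL0
      (hQ σ) ⟨i, hi, fun h => hiτ (h ▸ hkτ), hL1 i hiτ⟩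
    have hz := rescaledPower_singleton_tendsto_zero k (fun i => P.eval (i : ℝ)) c (Q {j}) hc
      (j := j) (by
        by_cases hjk : j = k
        · exact Or.inl hjk
        · exact Or.inr ⟨lt_of_le_of_ne (τ.le_max' j hj) hjk, hLz j hj hjk⟩)
    filter_upwards [hev, hz.eventually_lt_const hε] with H h1 h2
    exact h2.trans h1
  filter_upwards [key, eventually_gt_atTop 0] with H hkey hH
  refine ⟨WithLp.toLp 2 (Fin.cons (c * H ^ (k.val + 1)) fun e : Fin (2 * n) =>
    -(1 / 2) * H ^ (2 * (k.val + 1)) * P.coeff (e.val + 1)), fun j hj σ hσ hστ => ?_⟩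
  rw [dist_lt_dist_iff_power]
  rw [power_centroid_tallMomentPoint n N hH k c P hP {j} (Finset.singleton_nonempty j) _ rfl
    (tallMomentPoint n H j) (by simp),
    power_centroid_tallMomentPoint n N hH k c P hP σ hσ _ rfl _ rfl]
  have := hkey j hj σ hσ hστ
  gcongr

end Neighborly

section LayerWeight

variable {ι : Type*} [Fintype ι] [DecidableEq ι]

/-- The maximum of `0` and the values of `z` outside `τ`. -/
noncomputable def layerBot (τ : Finset ι) (z : ι → ℝ) : ℝ :=
  (Finset.insertNone τᶜ).sup' Finset.insertNone_nonempty fun o => o.elim 0 z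

/-- The minimal value of `z` on `τ`. -/
noncomputable def layerTop (τ : Finset ι) (z : ι → ℝ) : ℝ :=
  if h : τ.Nonempty then τ.inf' h z else 0

/-- The length of the interval of levels at which `τ` is a superlevel set of `z`. -/
noncomputable def layerWeight (τ : Finset ι) (z : ι → ℝ) : ℝ :=
  max (layerTop τ z - layerBot τ z) 0

theorem continuous_layerWeight (τ : Finset ι) : Continuous (layerWeight τ) := by
  have h1 : Continuous (layerBot τ) := by
    refine Continuous.finset_sup'_apply _ fun o _ => ?_
    cases o
    · exact continuous_const
    · exact continuous_apply _
  have h2 : Continuous (layerTop τ) := by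
    unfold layerTop
    split_ifs with h
    · exact Continuous.finset_inf'_apply _ fun i _ => continuous_apply i
    · exact continuous_const
  exact (h2.sub h1).max continuous_const

theorem layerBot_lt_iff {τ : Finset ι} {z : ι → ℝ} {θ : ℝ} :
    layerBot τ z < θ ↔ 0 < θ ∧ ∀ j ∉ τ, z j < θ := by
  rw [layerBot, Finset.sup'_lt_iff, Option.forall]
  simp

omit [Fintype ι] [DecidableEq ι] in
theorem le_layerTop_iff {τ : Finset ι} {z : ι → ℝ} {θ : ℝ} (hτ : τ.Nonempty) :
    θ ≤ layerTop τ z ↔ ∀ i ∈ τ, θ ≤ z i := by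
  simp [layerTop, hτ, Finset.le_inf'_iff]

theorem layerBot_nonneg (τ : Finset ι) (z : ι → ℝ) : 0 ≤ layerBot τ z := by
  by_contra! h
  exact lt_irrefl _ (layerBot_lt_iff.1 h).1

theorem layerWeight_nonneg (τ : Finset ι) (z : ι → ℝ) : 0 ≤ layerWeight τ z := le_max_right _ _

theorem layerWeight_pos {τ : Finset ι} {z : ι → ℝ} (h : layerWeight τ z ≠ 0) :
    τ.Nonempty ∧ (∀ i ∈ τ, 0 < z i) ∧ ∀ i ∈ τ, ∀ j ∉ τ, z j < z i := by
  have h1 : layerBot τ z < layerTop τ z := by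
    by_contra! h'
    exact h (max_eq_right (by linarith))
  have hne : τ.Nonempty := by
    by_contra hne
    have := layerBot_nonneg τ z
    rw [layerTop, dif_neg hne] at h1
    linarith
  obtain ⟨h2, h3⟩ := layerBot_lt_iff.1 h1
  have h4 := (le_layerTop_iff (θ := layerTop τ z) hne).1 le_rfl
  exact ⟨hne, fun i hi => h2.trans_le (h4 i hi), fun i hi j hj => (h3 j hj).trans_le (h4 i hi)⟩

theorem sum_layerWeight (z : ι → ℝ) (i : ι) (hz : 0 ≤ z i) :
    ∑ τ with i ∈ τ, layerWeight τ z = z i := by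
  have hmem : ∀ τ : Finset ι, τ.Nonempty → ∀ θ, θ ∈ Set.Ioc (layerBot τ z) (layerTop τ z) ↔
      0 < θ ∧ τ = Finset.univ.filter fun j => θ ≤ z j := by
    intro τ hτ θ
    rw [Set.mem_Ioc, layerBot_lt_iff, le_layerTop_iff hτ, and_assoc]
    refine and_congr_right fun _ => ⟨fun ⟨h1, h2⟩ => ?_, ?_⟩
    · ext j
      simp only [Finset.mem_filter, Finset.mem_univ, true_and]
      exact ⟨h2 j, fun h => by_contra fun hj => (h1 j hj).not_ge h⟩
    · intro h
      rw [h]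
      simp
  have hU : (⋃ τ ∈ (Finset.univ.filter fun τ : Finset ι => i ∈ τ),
      Set.Ioc (layerBot τ z) (layerTop τ z)) = Set.Ioc 0 (z i) := by
    ext θ
    simp only [Set.mem_iUnion, Finset.mem_filter, Finset.mem_univ, true_and, exists_prop]
    constructor
    · rintro ⟨τ, hi, h⟩
      obtain ⟨h0, h⟩ := (hmem τ ⟨i, hi⟩ θ).1 h
      rw [h] at hi
      exact ⟨h0, by simpa using hi⟩
    · rintro ⟨h0, h⟩
      have hi : i ∈ Finset.univ.filter fun j => θ ≤ z j := by simpa using h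
      exact ⟨_, hi, (hmem _ ⟨i, hi⟩ θ).2 ⟨h0, rfl⟩⟩
  have h := congrArg (MeasureTheory.volume.real) hU
  rw [MeasureTheory.measureReal_biUnion_finset (h := fun _ _ => measure_Ioc_lt_top.ne)] at h
  · simp only [Real.volume_real_Ioc, sub_zero] at h
    rw [max_eq_left hz] at h
    exact h
  · intro τ hτ σ hσ hne
    simp only [Finset.coe_filter, Finset.mem_univ, true_and, Set.mem_ofPred_eq] at hτ hσ
    refine Set.disjoint_left.2 fun θ h1 h2 => hne ?_
    rw [((hmem τ ⟨i, hτ⟩ θ).1 h1).2, ((hmem σ ⟨i, hσ⟩ θ).1 h2).2]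
  · exact fun _ _ => measurableSet_Ioc

theorem sum_card_mul_layerWeight (z : ι → ℝ) (hz : ∀ i, 0 ≤ z i) :
    ∑ τ : Finset ι, τ.card * layerWeight τ z = ∑ i, z i := by
  calc ∑ τ : Finset ι, τ.card * layerWeight τ z
      = ∑ τ : Finset ι, ∑ i : ι, if i ∈ τ then layerWeight τ z else 0 := by
        refine Finset.sum_congr rfl fun τ _ => ?_
        simp
    _ = ∑ i, z i := by
        rw [Finset.sum_comm]
        refine Finset.sum_congr rfl fun i _ => ?_
        rw [← Finset.sum_filter, sum_layerWeight z i (hz i)]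

theorem eq_of_layerWeight_eq {z z' : ι → ℝ} (hz : ∀ i, 0 ≤ z i) (hz' : ∀ i, 0 ≤ z' i)
    (h : ∀ τ, layerWeight τ z = layerWeight τ z') : z = z' := by
  funext i
  rw [← sum_layerWeight z i (hz i), ← sum_layerWeight z' i (hz' i)]
  exact Finset.sum_congr rfl fun τ _ => h τ

/-- The sets of positive layer weight form a chain. -/
theorem card_filter_layerWeight_le {z : ι → ℝ} {m : ℕ}
    (hm : ∀ τ : Finset ι, layerWeight τ z ≠ 0 → τ.card ≤ m) :
    (Finset.univ.filter fun τ : Finset ι => layerWeight τ z ≠ 0).card ≤ m := by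
  have hm' : (Finset.Icc 1 m).card = m := by simp
  rw [← hm']
  refine Finset.card_le_card_of_injOn Finset.card ?_ ?_
  · intro τ hτ
    have hτ : layerWeight τ z ≠ 0 := by simpa using hτ
    simpa using ⟨(layerWeight_pos hτ).1, hm τ hτ⟩
  · intro τ hτ σ hσ hcard
    have hτ : layerWeight τ z ≠ 0 := by simpa using hτ
    have hσ : layerWeight σ z ≠ 0 := by simpa using hσ
    refine Finset.eq_of_subset_of_card_le ?_ hcard.ge
    intro i hi
    by_contra hiσ
    have : ¬ σ ⊆ τ := fun hs => hiσ (Finset.eq_of_subset_of_card_le hs hcard.le ▸ hi)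
    obtain ⟨j, hj, hjτ⟩ := Finset.not_subset.1 this
    exact lt_asymm ((layerWeight_pos hτ).2.2 i hi j hjτ) ((layerWeight_pos hσ).2.2 j hj i hiσ)

end LayerWeight

section SegmentHomotopy

/-- Two maps into a subset of a topological vector space are homotopic if the segments between
corresponding values stay in that subset. -/
theorem ContinuousMap.homotopic_of_segment_subset {X V : Type*} [TopologicalSpace X] [AddCommGroup V]
    [Module ℝ V] [TopologicalSpace V] [ContinuousAdd V] [ContinuousSMul ℝ V] {W : Set V}
    (f g : C(X, W)) (h : ∀ x, segment ℝ (f x : V) (g x) ⊆ W) : f.Homotopic g := by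
  refine ⟨⟨⟨fun a => ⟨(1 - (a.1 : ℝ)) • (f a.2 : V) + (a.1 : ℝ) • (g a.2 : V), h a.2
    ⟨1 - a.1, a.1, sub_nonneg.2 a.1.2.2, a.1.2.1, by ring, rfl⟩⟩, ?_⟩, ?_, ?_⟩⟩
  · fun_prop
  · intro x; ext; simp
  · intro x; ext; simp

end SegmentHomotopy

section VoronoiNerve

variable {E : Type*} [NormedAddCommGroup E] [InnerProductSpace ℝ E]

theorem convex_setOf_dist_sq_add_le (a b : E) (δ : ℝ) :
    Convex ℝ {x | dist x a ^ 2 + δ ≤ dist x b ^ 2} := by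
  have : {x | dist x a ^ 2 + δ ≤ dist x b ^ 2} =
      {x | inner ℝ (b - a) x ≤ (‖b‖ ^ 2 - ‖a‖ ^ 2 - δ) / 2} := by
    ext x
    simp only [Set.mem_ofPred_eq, dist_eq_norm, norm_sub_sq_real, inner_sub_left,
      real_inner_comm x a, real_inner_comm x b]
    constructor <;> intro h <;> linarith
  rw [this]
  exact convex_halfSpace_le (innerSL ℝ (b - a)).toLinearMap.isLinear _

variable {ι : Type*} [Fintype ι] [DecidableEq ι]

/-- The points of the geometric realization of an abstract simplicial complex `F`, in barycentric
coordinates. -/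
def barycentricRealization (F : Set (Finset ι)) : Set (ι → ℝ) :=
  {z | (∀ i, 0 ≤ z i) ∧ ∑ i, z i = 1 ∧ ∃ τ ∈ F, ∀ i ∉ τ, z i = 0}

/-- The map from the barycentric realization which is affine on the simplices of the barycentric
subdivision and maps the barycenter of `τ` to `p τ`. -/
noncomputable def layerMap (p : Finset ι → E) (z : ι → ℝ) : E :=
  ∑ τ : Finset ι, (τ.card * layerWeight τ z) • p τ

theorem continuous_layerMap (p : Finset ι → E) : Continuous (layerMap p) :=
  continuous_finsetSum _ fun τ _ =>
    (continuous_const.mul (continuous_layerWeight τ)).smul continuous_const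

theorem layerMap_mem_of_convex {p : Finset ι → E} {z : ι → ℝ} (hz : ∀ i, 0 ≤ z i)
    (hz1 : ∑ i, z i = 1) {C : Set E} (hC : Convex ℝ C) (h : ∀ τ, layerWeight τ z ≠ 0 → p τ ∈ C) :
    layerMap p z ∈ C := by
  rw [layerMap, ← Finset.sum_filter_of_ne (p := fun τ => layerWeight τ z ≠ 0)]
  · refine hC.sum_mem (fun τ _ => mul_nonneg (Nat.cast_nonneg _) (layerWeight_nonneg τ z)) ?_ ?_
    · rw [Finset.sum_filter_of_ne, sum_card_mul_layerWeight z hz, hz1]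
      exact fun τ _ hτ h0 => hτ (by rw [h0, mul_zero])
    · exact fun τ hτ => h τ (Finset.mem_filter.1 hτ).2
  · exact fun τ _ hτ h0 => hτ (by rw [h0, mul_zero, zero_smul])

/-- The union of the cells of the points of the family `s` in the Voronoi complex of the points of
`s` and `R`. -/
def cellUnion (s : ι → E) (R : Set E) : Set E :=
  {x | ∃ i, ∀ r ∈ R, dist x (s i) ≤ dist x r}

/-- The unnormalized weights of the nerve map: positive for the points of the family `s` which are
nearest up to a squared distance `δ`. -/
noncomputable def nearWeight (s : ι → E) (δ : ℝ) (x : E) (i : ι) : ℝ :=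
  max 0 (δ + Metric.infDist x (Set.range s) ^ 2 - dist x (s i) ^ 2)

omit [InnerProductSpace ℝ E] [Fintype ι] [DecidableEq ι] in
theorem continuous_nearWeight (s : ι → E) (δ : ℝ) (i : ι) :
    Continuous fun x => nearWeight s δ x i := by
  unfold nearWeight
  have := Metric.continuous_infDist_pt (Set.range s)
  fun_prop

omit [InnerProductSpace ℝ E] [DecidableEq ι] in
theorem exists_infDist_eq_dist_range [Nonempty ι] (s : ι → E) (x : E) :
    ∃ i, Metric.infDist x (Set.range s) = dist x (s i) ∧ ∀ k, dist x (s i) ≤ dist x (s k) := by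
  obtain ⟨_, ⟨i, rfl⟩, hi⟩ :=
    (Set.finite_range s).isCompact.exists_infDist_eq_dist (Set.range_nonempty s) x
  exact ⟨i, hi, fun k => hi ▸ Metric.infDist_le_dist_of_mem ⟨k, rfl⟩⟩

/-- A configuration of points `s` and `R` together with points `p τ` indexed by the faces of a
complex `F` such that `F` is the nerve of the cells of the points of `s`, with margin `δ`. -/
structure IsVoronoiNerve (F : Set (Finset ι)) (s : ι → E) (p : Finset ι → E) (R : Set E) (δ : ℝ) :
    Prop where
  pos : 0 < δ
  down_closed : ∀ τ ∈ F, ∀ σ ⊆ τ, σ.Nonempty → σ ∈ F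
  dist_le : ∀ τ ∈ F, ∀ i ∈ τ, ∀ r ∈ R, dist (p τ) (s i) ≤ dist (p τ) r
  gap_le : ∀ τ ∈ F, ∀ i ∈ τ, ∀ k ∉ τ, dist (p τ) (s i) ^ 2 + δ ≤ dist (p τ) (s k) ^ 2
  mem_of_near : ∀ x i, (∀ r ∈ R, dist x (s i) ≤ dist x r) → ∀ σ : Finset ι, σ.Nonempty →
    (∀ k ∈ σ, dist x (s k) ^ 2 < dist x (s i) ^ 2 + δ) → σ ∈ F

variable {F : Set (Finset ι)} {s : ι → E} {p : Finset ι → E} {R : Set E} {δ : ℝ}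

theorem mem_of_layerWeight_ne_zero (hF : ∀ τ ∈ F, ∀ σ ⊆ τ, σ.Nonempty → σ ∈ F) {z : ι → ℝ}
    (hz : z ∈ barycentricRealization F) {τ : Finset ι} (hτ : layerWeight τ z ≠ 0) : τ ∈ F := by
  obtain ⟨_, _, σ, hσ, hzσ⟩ := hz
  obtain ⟨hne, hpos, _⟩ := layerWeight_pos hτ
  exact hF σ hσ τ (fun i hi => by_contra fun hi' => (hpos i hi).ne' (hzσ i hi')) hne

omit [Fintype ι] [DecidableEq ι] in
theorem convex_setOf_forall_dist_le (a : E) (R : Set E) :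
    Convex ℝ {x | ∀ r ∈ R, dist x a ≤ dist x r} := by
  have : {x | ∀ r ∈ R, dist x a ≤ dist x r} = ⋂ r ∈ R, {x | dist x a ^ 2 + 0 ≤ dist x r ^ 2} := by
    ext x
    simp [sq_le_sq₀ dist_nonneg dist_nonneg]
  rw [this]
  exact convex_iInter₂ fun r _ => convex_setOf_dist_sq_add_le a r 0

namespace IsVoronoiNerve

theorem layerMap_dist_le (h : IsVoronoiNerve F s p R δ) {z : ι → ℝ}
    (hz : z ∈ barycentricRealization F) {i : ι} (hi : ∀ k, z k ≤ z i) :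
    ∀ r ∈ R, dist (layerMap p z) (s i) ≤ dist (layerMap p z) r := by
  refine layerMap_mem_of_convex hz.1 hz.2.1 (convex_setOf_forall_dist_le (s i) R) fun τ hτ => ?_
  refine h.dist_le τ (mem_of_layerWeight_ne_zero h.down_closed hz hτ) i ?_
  obtain ⟨⟨k, hk⟩, _, hlt⟩ := layerWeight_pos hτ
  exact by_contra fun hiτ => (hlt k hk i hiτ).not_ge (hi k)

theorem nearWeight_layerMap (h : IsVoronoiNerve F s p R δ) {z : ι → ℝ}
    (hz : z ∈ barycentricRealization F) {k : ι} (hk : z k = 0) :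
    nearWeight s δ (layerMap p z) k = 0 := by
  have : Nonempty ι := ⟨k⟩
  obtain ⟨i, hi⟩ := Finite.exists_max z
  have hmem : layerMap p z ∈ {x | dist x (s i) ^ 2 + δ ≤ dist x (s k) ^ 2} := by
    refine layerMap_mem_of_convex hz.1 hz.2.1 (convex_setOf_dist_sq_add_le _ _ _) fun τ hτ => ?_
    obtain ⟨⟨l, hl⟩, hpos, hlt⟩ := layerWeight_pos hτ
    exact h.gap_le τ (mem_of_layerWeight_ne_zero h.down_closed hz hτ) i
      (by_contra fun hiτ => (hlt l hl i hiτ).not_ge (hi l)) k fun hkτ => (hpos k hkτ).ne' hk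
  have h1 : Metric.infDist (layerMap p z) (Set.range s) ≤ dist (layerMap p z) (s i) :=
    Metric.infDist_le_dist_of_mem ⟨i, rfl⟩
  have h2 := pow_le_pow_left₀ Metric.infDist_nonneg h1 2
  have h3 : dist (layerMap p z) (s i) ^ 2 + δ ≤ dist (layerMap p z) (s k) ^ 2 := hmem
  exact max_eq_left (by linarith)

omit [InnerProductSpace ℝ E] [DecidableEq ι] in
/-- The normalized near weights are maximal at a nearest point of the family. -/
theorem exists_nearWeight_max (h : IsVoronoiNerve F s p R δ) {x : E} (hx : x ∈ cellUnion s R) :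
    ∃ i, (∀ r ∈ R, dist x (s i) ≤ dist x r) ∧ nearWeight s δ x i = δ ∧
      (∀ k, nearWeight s δ x k ≤ δ) ∧
      ∀ k, nearWeight s δ x k ≠ 0 → dist x (s k) ^ 2 < dist x (s i) ^ 2 + δ := by
  obtain ⟨l, hl⟩ := hx
  have : Nonempty ι := ⟨l⟩
  obtain ⟨i, hi, hmin⟩ := exists_infDist_eq_dist_range s x
  refine ⟨i, fun r hr => (hmin l).trans (hl r hr), ?_, fun k => ?_, fun k hk => ?_⟩
  · simp [nearWeight, hi, h.pos.le]
  · have := pow_le_pow_left₀ dist_nonneg (hmin k) 2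
    rw [nearWeight, hi]
    exact max_le h.pos.le (by linarith)
  · by_contra! hle
    rw [nearWeight, hi] at hk
    exact hk (max_eq_left (by linarith))

omit [DecidableEq ι] [InnerProductSpace ℝ E] in
theorem sum_nearWeight_pos (h : IsVoronoiNerve F s p R δ) {x : E} (hx : x ∈ cellUnion s R) :
    0 < ∑ i, nearWeight s δ x i := by
  obtain ⟨i, _, hi, _⟩ := h.exists_nearWeight_max hx
  exact Finset.sum_pos' (fun _ _ => le_max_left _ _) ⟨i, Finset.mem_univ i, h.pos.trans_eq hi.symm⟩

omit [DecidableEq ι] [InnerProductSpace ℝ E] in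
theorem nearWeight_div_mem (h : IsVoronoiNerve F s p R δ) {x : E} (hx : x ∈ cellUnion s R) :
    (fun i => nearWeight s δ x i / ∑ k, nearWeight s δ x k) ∈ barycentricRealization F := by
  have hpos := h.sum_nearWeight_pos hx
  refine ⟨fun i => div_nonneg (le_max_left _ _) hpos.le, ?_, ?_⟩
  · rw [← Finset.sum_div, div_self hpos.ne']
  · obtain ⟨i, hR, hi, _, hnear⟩ := h.exists_nearWeight_max hx
    refine ⟨Finset.univ.filter fun k => nearWeight s δ x k ≠ 0, ?_, fun k hk => ?_⟩
    · refine h.mem_of_near x i hR _ ⟨i, ?_⟩ fun k hk => hnear k (by simpa using hk)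
      simpa [hi] using h.pos.ne'
    · have : nearWeight s δ x k = 0 := by simpa using hk
      simp only [this, zero_div]

/-- The realization of the nerve is homotopy equivalent to the union of the cells. -/
theorem exists_homotopyEquiv (h : IsVoronoiNerve F s p R δ) :
    ∃ (f : C(barycentricRealization F, cellUnion s R)) (g : C(cellUnion s R, barycentricRealization F)),
      (∀ z, (f z : E) = layerMap p z) ∧
      (f.comp g).Homotopic (ContinuousMap.id _) ∧ (g.comp f).Homotopic (ContinuousMap.id _) := by
  have hmem : ∀ z ∈ barycentricRealization F, layerMap p z ∈ cellUnion s R := by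
    intro z hz
    have : Nonempty ι := by
      by_contra hne
      rw [not_nonempty_iff] at hne
      simpa using hz.2.1
    obtain ⟨i, hi⟩ := Finite.exists_max z
    exact ⟨i, h.layerMap_dist_le hz hi⟩
  let f : C(barycentricRealization F, cellUnion s R) :=
    ⟨fun z => ⟨layerMap p z, hmem z z.2⟩,
      ((continuous_layerMap p).comp continuous_subtype_val).subtype_mk _⟩
  let g : C(cellUnion s R, barycentricRealization F) :=
    ⟨fun x => ⟨fun i => nearWeight s δ x i / ∑ k, nearWeight s δ x k, h.nearWeight_div_mem x.2⟩, by
      refine Continuous.subtype_mk (continuous_pi fun i => ?_) _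
      refine ((continuous_nearWeight s δ i).comp continuous_subtype_val).div
        (continuous_finsetSum _ fun k _ =>
          (continuous_nearWeight s δ k).comp continuous_subtype_val) ?_
      exact fun x => (h.sum_nearWeight_pos x.2).ne'⟩
  refine ⟨f, g, fun _ => rfl, ContinuousMap.homotopic_of_segment_subset _ _ fun x => ?_,
    ContinuousMap.homotopic_of_segment_subset _ _ fun z => ?_⟩
  · obtain ⟨i, hR, hi, hmax, _⟩ := h.exists_nearWeight_max x.2
    have h1 : ∀ r ∈ R, dist (layerMap p (g x : ι → ℝ)) (s i) ≤ dist (layerMap p (g x : ι → ℝ)) r := by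
      refine h.layerMap_dist_le (g x).2 fun k => ?_
      refine div_le_div_of_nonneg_right ?_ (h.sum_nearWeight_pos x.2).le
      rw [hi]
      exact hmax k
    intro y hy
    exact ⟨i, (convex_setOf_forall_dist_le (s i) R).segment_subset h1 hR hy⟩
  · rintro _ ⟨a, b, ha, hb, hab, rfl⟩
    obtain ⟨hz0, hz1, σ, hσ, hzσ⟩ := z.2
    obtain ⟨hg0, hg1, _⟩ := (g (f z)).2
    refine ⟨fun i => ?_, ?_, σ, hσ, fun i hi => ?_⟩
    · exact add_nonneg (mul_nonneg ha (hg0 i)) (mul_nonneg hb (hz0 i))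
    · simp only [Pi.add_apply, Pi.smul_apply, smul_eq_mul, Finset.sum_add_distrib, ← Finset.mul_sum]
      change a * ∑ i, (g (f z) : ι → ℝ) i + b * ∑ i, (z : ι → ℝ) i = 1
      rw [hg1, hz1, mul_one, mul_one, hab]
    · have h0 : (g (f z) : ι → ℝ) i = 0 := by
        change nearWeight s δ (layerMap p z) i / _ = 0
        rw [h.nearWeight_layerMap z.2 (hzσ i hi), zero_div]
      change a * (g (f z) : ι → ℝ) i + b * (z : ι → ℝ) i = 0
      rw [h0, hzσ i hi, mul_zero, mul_zero, add_zero]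

end IsVoronoiNerve

end VoronoiNerve

section Realization

theorem AffineIndependent.eq_of_sum_smul_eq {κ V : Type*} [Fintype κ] [AddCommGroup V] [Module ℝ V]
    {p : κ → V} {T : Finset κ} (hp : AffineIndependent ℝ fun i : T => p i) {w w' : κ → ℝ}
    (hw : ∀ i ∉ T, w i = 0) (hw' : ∀ i ∉ T, w' i = 0) (h0 : ∑ i, w i = ∑ i, w' i)
    (h1 : ∑ i, w i • p i = ∑ i, w' i • p i) : w = w' := by
  classical
  have hr : ∑ i ∈ T, (w i - w' i) = 0 := by
    rw [Finset.sum_subset (Finset.subset_univ T) fun i _ hi => by rw [hw i hi, hw' i hi, sub_zero],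
      Finset.sum_sub_distrib, h0, sub_self]
  have hs : ∑ i ∈ T, (w i - w' i) • p i = 0 := by
    rw [Finset.sum_subset (Finset.subset_univ T) fun i _ hi => by
      rw [hw i hi, hw' i hi, sub_zero, zero_smul]]
    simp only [sub_smul, Finset.sum_sub_distrib, h1, sub_self]
  rw [← Finset.sum_attach] at hr hs
  have := affineIndependent_iff.1 hp T.attach (fun i => w i - w' i) hr hs
  funext i
  by_cases hi : i ∈ T
  · exact sub_eq_zero.1 (this ⟨i, hi⟩ (Finset.mem_attach _ _))
  · rw [hw i hi, hw' i hi]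

/-- If the points `p τ` are sufficiently independent then `layerMap p` is injective. -/
theorem layerMap_injOn {E ι : Type*} [NormedAddCommGroup E] [InnerProductSpace ℝ E] [Fintype ι]
    [DecidableEq ι] {F : Set (Finset ι)} (hF : ∀ τ ∈ F, ∀ σ ⊆ τ, σ.Nonempty → σ ∈ F) {m : ℕ}
    (hm : ∀ τ ∈ F, τ.card ≤ m) {p : Finset ι → E}
    (hp : ∀ T : Finset (Finset ι), T.card ≤ m + m → AffineIndependent ℝ fun τ : T => p τ) :
    Set.InjOn (layerMap p) (barycentricRealization F) := by
  intro z hz z' hz' h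
  let T : (ι → ℝ) → Finset (Finset ι) := fun z => Finset.univ.filter fun τ => layerWeight τ z ≠ 0
  have hT : ∀ z ∈ barycentricRealization F, (T z).card ≤ m := fun z hz =>
    card_filter_layerWeight_le fun τ hτ => hm τ (mem_of_layerWeight_ne_zero hF hz hτ)
  have h0 : ∀ z, ∀ τ ∉ T z, (τ.card : ℝ) * layerWeight τ z = 0 := by
    intro z τ hτ
    have : layerWeight τ z = 0 := by simpa [T] using hτ
    rw [this, mul_zero]
  have key := (hp (T z ∪ T z') ((Finset.card_union_le _ _).trans
    (add_le_add (hT z hz) (hT z' hz')))).eq_of_sum_smul_eq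
      (w := fun τ => τ.card * layerWeight τ z) (w' := fun τ => τ.card * layerWeight τ z')
      (fun τ hτ => h0 z τ fun h => hτ (Finset.mem_union_left _ h))
      (fun τ hτ => h0 z' τ fun h => hτ (Finset.mem_union_right _ h))
      (by rw [sum_card_mul_layerWeight z hz.1, sum_card_mul_layerWeight z' hz'.1, hz.2.1, hz'.2.1]) h
  refine eq_of_layerWeight_eq hz.1 hz'.1 fun τ => ?_
  rcases τ.eq_empty_or_nonempty with rfl | hne
  · have : ∀ z : ι → ℝ, layerWeight ∅ z = 0 := fun z =>
      by_contra fun h => Finset.not_nonempty_empty (layerWeight_pos h).1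
    rw [this, this]
  · exact mul_left_cancel₀ (by exact_mod_cast hne.card_pos.ne') (congrFun key τ)

theorem isCompact_barycentricRealization {ι : Type*} [Fintype ι] (F : Set (Finset ι)) :
    IsCompact (barycentricRealization F) := by
  have : barycentricRealization F =
      stdSimplex ℝ ι ∩ ⋃ τ ∈ F, {z : ι → ℝ | ∀ i ∉ τ, z i = 0} := by
    ext z
    simp [barycentricRealization, stdSimplex, and_assoc]
  rw [this]
  refine (isCompact_stdSimplex ℝ ι).inter_right (Set.Finite.isClosed_biUnion (Set.toFinite F)
    fun τ _ => ?_)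
  simp only [Set.ofPred_forall]
  exact isClosed_iInter fun i => isClosed_iInter fun _ =>
    isClosed_eq (continuous_apply i) continuous_const

variable {V : Type*} [AddCommGroup V] [Module ℝ V]

namespace Geometry.SimplicialComplex

/-- The faces of a geometric simplicial complex as sets of vertices. -/
def vertexFaces (K : SimplicialComplex ℝ V) : Set (Finset K.vertices) :=
  {τ | τ.map (Function.Embedding.subtype _) ∈ K.faces}

theorem exists_barycentric (K : SimplicialComplex ℝ V) [Fintype K.vertices] {s : Finset V}
    (hs : s ∈ K.faces) {x : V} (hx : x ∈ convexHull ℝ (s : Set V)) :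
    ∃ z : K.vertices → ℝ, (∀ i, 0 ≤ z i) ∧ ∑ i, z i = 1 ∧ (∀ i : K.vertices, (i : V) ∉ s → z i = 0) ∧
      ∑ i, z i • (i : V) = x := by
  classical
  have hsv : ∀ y ∈ s, y ∈ K.vertices := fun y hy =>
    K.down_closed hs (Finset.singleton_subset_iff.2 hy) (Finset.singleton_nonempty y)
  obtain ⟨w, hw0, hw1, hwx⟩ := Finset.mem_convexHull'.1 hx
  refine ⟨fun i => if i ∈ s.subtype (· ∈ K.vertices) then w i else 0, fun i => ?_, ?_, fun i hi => ?_,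
    ?_⟩
  · dsimp only
    split_ifs with h
    · exact hw0 _ (Finset.mem_subtype.1 h)
    · exact le_rfl
  · rw [Finset.sum_ite_mem, Finset.univ_inter, Finset.sum_subtype_of_mem w hsv, hw1]
  · exact if_neg fun h => hi (Finset.mem_subtype.1 h)
  · simp only [ite_smul, zero_smul]
    rw [Finset.sum_ite_mem, Finset.univ_inter, Finset.sum_subtype_of_mem (fun y => w y • y) hsv, hwx]

theorem sum_smul_mem_convexHull (K : SimplicialComplex ℝ V) [Fintype K.vertices]
    {z : K.vertices → ℝ} (hz : ∀ i, 0 ≤ z i) (hz1 : ∑ i, z i = 1) {τ : Finset K.vertices}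
    (hτ : ∀ i ∉ τ, z i = 0) :
    ∑ i, z i • (i : V) ∈ convexHull ℝ (τ.map (Function.Embedding.subtype _) : Set V) := by
  rw [← Finset.sum_subset (Finset.subset_univ τ) fun i _ hi => by rw [hτ i hi, zero_smul]]
  rw [← Finset.sum_subset (Finset.subset_univ τ) fun i _ hi => hτ i hi] at hz1
  refine (convex_convexHull ℝ _).sum_mem (fun i _ => hz i) hz1 fun i hi => ?_
  exact subset_convexHull ℝ _ (by simpa using hi)

theorem sum_smul_injOn (K : SimplicialComplex ℝ V) [Fintype K.vertices] :
    Set.InjOn (fun z : K.vertices → ℝ => ∑ i, z i • (i : V))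
      (barycentricRealization K.vertexFaces) := by
  classical
  rintro z ⟨hz, hz1, τ, hτ, hzτ⟩ z' ⟨hz', hz1', τ', hτ', hzτ'⟩ h
  dsimp only at h
  have hx := K.sum_smul_mem_convexHull hz hz1 hzτ
  have hx' := K.sum_smul_mem_convexHull hz' hz1' hzτ'
  rw [← h] at hx'
  have hmem := K.inter_subset_convexHull hτ hτ' ⟨hx, hx'⟩
  rw [← Finset.coe_inter] at hmem
  have hface := K.down_closed hτ Finset.inter_subset_left (t := τ.map (Function.Embedding.subtype _) ∩
    τ'.map (Function.Embedding.subtype _)) (by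
      exact Finset.coe_nonempty.1 (convexHull_nonempty_iff.1 ⟨_, hmem⟩))
  obtain ⟨u, _, hu1, huT, hux⟩ := K.exists_barycentric hface hmem
  have hind : ∀ τ ∈ K.vertexFaces, AffineIndependent ℝ fun i : τ => ((i : K.vertices) : V) := by
    intro τ hτ
    exact (K.indep hτ).comp_embedding ⟨fun i : τ => (⟨i, Finset.mem_map_of_mem _ i.2⟩ :
      (τ.map (Function.Embedding.subtype _) : Finset V)), fun a b hab => by
        exact Subtype.ext (Subtype.ext (Subtype.mk.inj hab))⟩
  have e1 := (hind τ hτ).eq_of_sum_smul_eq (w := z) (w' := u) hzτ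
    (fun i hi => huT i fun h => hi (by simpa using (Finset.mem_inter.1 h).1)) (hz1.trans hu1.symm)
    hux.symm
  have e2 := (hind τ' hτ').eq_of_sum_smul_eq (w := z') (w' := u) hzτ'
    (fun i hi => huT i fun h => hi (by simpa using (Finset.mem_inter.1 h).2)) (hz1'.trans hu1.symm)
    (h.symm.trans hux.symm)
  rw [e1, e2]

/-- The underlying space of a finite simplicial complex is homeomorphic to its realization in
barycentric coordinates. -/
theorem nonempty_homeomorph_barycentricRealization [TopologicalSpace V] [T2Space V]
    [ContinuousAdd V] [ContinuousSMul ℝ V] (K : SimplicialComplex ℝ V) [Fintype K.vertices] :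
    Nonempty (barycentricRealization K.vertexFaces ≃ₜ K.space) := by
  have hmem : ∀ z ∈ barycentricRealization K.vertexFaces, ∑ i, z i • (i : V) ∈ K.space := by
    rintro z ⟨hz, hz1, τ, hτ, hzτ⟩
    exact mem_space_iff.2 ⟨_, hτ, K.sum_smul_mem_convexHull hz hz1 hzτ⟩
  let f : barycentricRealization K.vertexFaces → K.space := fun z => ⟨_, hmem z z.2⟩
  have hf : Continuous f := by
    refine Continuous.subtype_mk (continuous_finsetSum _ fun i _ => ?_) _
    exact ((continuous_apply i).comp continuous_subtype_val).smul continuous_const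
  have hbij : Function.Bijective f := by
    refine ⟨fun z z' h => Subtype.ext (K.sum_smul_injOn z.2 z'.2 (congrArg Subtype.val h)), ?_⟩
    rintro ⟨x, hx⟩
    obtain ⟨s, hs, hxs⟩ := mem_space_iff.1 hx
    obtain ⟨z, hz, hz1, hzs, hzx⟩ := K.exists_barycentric hs hxs
    have hsv : ∀ y ∈ s, y ∈ K.vertices := fun y hy =>
      K.down_closed hs (Finset.singleton_subset_iff.2 hy) (Finset.singleton_nonempty y)
    classical
    refine ⟨⟨z, hz, hz1, s.subtype (· ∈ K.vertices), ?_, fun i hi => hzs i (by simpa using hi)⟩,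
      Subtype.ext hzx⟩
    change Finset.map _ _ ∈ K.faces
    rwa [Finset.subtype_map_of_mem hsv]
  have : CompactSpace (barycentricRealization K.vertexFaces) :=
    isCompact_iff_compactSpace.1 (isCompact_barycentricRealization _)
  exact ⟨Continuous.homeoOfEquivCompactToT2 (f := Equiv.ofBijective f hbij) hf⟩

end Geometry.SimplicialComplex

theorem exists_embedding_of_homotopyEquiv {X A E : Type*} [TopologicalSpace X] [TopologicalSpace A]
    [TopologicalSpace E] [CompactSpace A] [T2Space E] {U : Set E} (h : A ≃ₜ X) (f : C(A, U))
    (g : C(U, A)) (hf : Function.Injective f) (h1 : (f.comp g).Homotopic (ContinuousMap.id _))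
    (h2 : (g.comp f).Homotopic (ContinuousMap.id _)) :
    ∃ j : C(X, E), Topology.IsEmbedding j ∧ ∃ hsub : Set.range j ⊆ U, ∃ g' : C(U, Set.range j),
      ((⟨Set.inclusion hsub, continuous_inclusion hsub⟩ : C(Set.range j, U)).comp g').Homotopic
        (ContinuousMap.id _) ∧
      (g'.comp ⟨Set.inclusion hsub, continuous_inclusion hsub⟩).Homotopic (ContinuousMap.id _) := by
  have : CompactSpace X := h.compactSpace
  let j : C(X, E) := ⟨fun x => f (h.symm x), by fun_prop⟩
  have hj : Topology.IsEmbedding j := (j.continuous.isClosedEmbedding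
    (Subtype.val_injective.comp (hf.comp h.symm.injective))).isEmbedding
  let e : X ≃ₜ Set.range j := hj.toHomeomorph
  have hsub : Set.range j ⊆ U := by
    rintro _ ⟨x, rfl⟩
    exact (f (h.symm x)).2
  let a : C(A, Set.range j) := ⟨fun z => e (h z), by fun_prop⟩
  let b : C(Set.range j, A) := ⟨fun y => h.symm (e.symm y), by fun_prop⟩
  have hb : ∀ y, f (b y) = Set.inclusion hsub y := by
    intro y
    refine Subtype.ext ?_
    change ((e (e.symm y) : Set.range j) : E) = y
    rw [e.apply_symm_apply]
  refine ⟨j, hj, hsub, a.comp g, ?_, ?_⟩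
  · convert! h1 using 1
    ext x
    change (f (h.symm (h (g x))) : E) = f (g x)
    rw [h.symm_apply_apply]
  · have h3 : (a.comp ((g.comp f).comp b)).Homotopic (a.comp ((ContinuousMap.id A).comp b)) :=
      (ContinuousMap.Homotopic.refl a).comp (h2.comp (ContinuousMap.Homotopic.refl b))
    convert! h3 using 1
    · ext y
      change _ = ((a (g (f (b y))) : Set.range j) : E)
      rw [hb]
      rfl
    · ext y
      change (y : E) = ((e (h (h.symm (e.symm y))) : Set.range j) : E)
      rw [h.apply_symm_apply, e.apply_symm_apply]

end Realization

section Configuration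

theorem exists_neighborly_family_of_fintype (n : ℕ) (ι : Type*) [Fintype ι] :
    ∃ (s : ι → EuclideanSpace ℝ (Fin (2 * n + 1)))
      (p : Finset ι → EuclideanSpace ℝ (Fin (2 * n + 1))), Function.Injective s ∧
      ∀ τ : Finset ι, τ.Nonempty → τ.card ≤ n + 1 → ∀ i ∈ τ, ∀ σ : Finset ι, σ.Nonempty → ¬ σ ⊆ τ →
        dist (p τ) (s i) < dist (p τ) ((σ.card : ℝ)⁻¹ • ∑ k ∈ σ, s k) := by
  classical
  obtain ⟨s, hs⟩ := exists_neighborly_family n (Fintype.card ι)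
  let e := (Fintype.equivFin ι).toEmbedding
  have key : ∀ τ : Finset ι, ∃ p : EuclideanSpace ℝ (Fin (2 * n + 1)), τ.Nonempty → τ.card ≤ n + 1 →
      ∀ i ∈ τ, ∀ σ : Finset ι, σ.Nonempty → ¬ σ ⊆ τ →
        dist p (s (e i)) < dist p ((σ.card : ℝ)⁻¹ • ∑ k ∈ σ, s (e k)) := by
    intro τ
    by_cases h : τ.Nonempty ∧ τ.card ≤ n + 1
    · obtain ⟨p, hp⟩ := hs (τ.map e) (h.1.map) (by rw [Finset.card_map]; exact h.2)
      refine ⟨p, fun _ _ i hi σ hσ hστ => ?_⟩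
      have := hp (e i) (Finset.mem_map_of_mem e hi) (σ.map e) hσ.map
        (by rwa [Finset.map_subset_map])
      rwa [Finset.card_map, Finset.sum_map] at this
    · exact ⟨0, fun h1 h2 => absurd ⟨h1, h2⟩ h⟩
  choose p hp using key
  refine ⟨fun i => s (e i), p, fun i k hik => ?_, hp⟩
  by_contra hne
  have := hp {i} (Finset.singleton_nonempty i) (by simp) i (Finset.mem_singleton_self i) {k}
    (Finset.singleton_nonempty k) (by simpa using Ne.symm hne)
  dsimp only at hik
  simp [hik] at this

/-- The vertices of a large cross-polytope. -/
noncomputable def framePoint {d : ℕ} (L : ℝ) (q : Fin d × Bool) : EuclideanSpace ℝ (Fin d) :=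
  EuclideanSpace.single q.1 (if q.2 then L else -L)

theorem norm_framePoint {d : ℕ} {L : ℝ} (hL : 0 ≤ L) (q : Fin d × Bool) :
    ‖framePoint L q‖ = L := by
  rw [framePoint, PiLp.norm_single, Real.norm_eq_abs]
  split_ifs <;> simp [abs_of_nonneg hL]

theorem norm_le_of_le_dist_framePoint {d : ℕ} {D L : ℝ} (hD : 0 ≤ D) (hL : d * D + 1 ≤ L)
    (x : EuclideanSpace ℝ (Fin d)) (h : ∀ q, ‖x‖ - D ≤ dist x (framePoint L q)) :
    ‖x‖ ≤ d * L ^ 2 + D := by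
  rcases le_total ‖x‖ D with hx | hx
  · have : 0 ≤ d * L ^ 2 := by positivity
    linarith
  have hL0 : 0 ≤ L := le_trans (by positivity) hL
  have h1 : ∀ l, 2 * L * |x l| ≤ L ^ 2 + 2 * D * ‖x‖ := by
    intro l
    have key : ∀ b : Bool, 2 * ((if b then L else -L) * x l) ≤ L ^ 2 + 2 * D * ‖x‖ := by
      intro b
      have h2 := pow_le_pow_left₀ (sub_nonneg.2 hx) (h (l, b)) 2
      rw [dist_eq_norm, norm_sub_sq_real, norm_framePoint hL0, framePoint,
        EuclideanSpace.inner_single_right] at h2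
      simp only [conj_trivial] at h2
      nlinarith [sq_nonneg D]
    rcases abs_cases (x l) with ⟨h3, _⟩ | ⟨h3, _⟩ <;> rw [h3]
    · have := key true
      simp only [if_true] at this
      linarith
    · have := key false
      simp only [Bool.false_eq_true, if_false] at this
      linarith
  have h2 : ‖x‖ ≤ ∑ l, |x l| := by
    conv_lhs => rw [← (EuclideanSpace.basisFun (Fin d) ℝ).sum_repr x]
    refine (norm_sum_le _ _).trans (Finset.sum_le_sum fun l _ => ?_)
    simp [norm_smul]
  have h3 : 2 * L * ‖x‖ ≤ d * (L ^ 2 + 2 * D * ‖x‖) := by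
    calc 2 * L * ‖x‖ ≤ 2 * L * ∑ l, |x l| := by gcongr
      _ = ∑ l, 2 * L * |x l| := Finset.mul_sum _ _ _
      _ ≤ ∑ _l : Fin d, (L ^ 2 + 2 * D * ‖x‖) := Finset.sum_le_sum fun l _ => h1 l
      _ = d * (L ^ 2 + 2 * D * ‖x‖) := by
        rw [Finset.sum_const, Finset.card_univ, Fintype.card_fin, nsmul_eq_mul]
  have h4 : (d * D + 1) * ‖x‖ ≤ L * ‖x‖ := by gcongr
  nlinarith [norm_nonneg x, sq_nonneg L, mul_nonneg (Nat.cast_nonneg d : (0 : ℝ) ≤ d) (sq_nonneg L)]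

theorem average_dist_sq {E ι : Type*} [NormedAddCommGroup E] [InnerProductSpace ℝ E] (s : ι → E)
    {σ : Finset ι} (hσ : σ.Nonempty) (x : E) :
    (σ.card : ℝ)⁻¹ * ∑ i ∈ σ, dist x (s i) ^ 2 =
      ‖x‖ ^ 2 - 2 * inner ℝ x ((σ.card : ℝ)⁻¹ • ∑ i ∈ σ, s i) +
        (σ.card : ℝ)⁻¹ * ∑ i ∈ σ, ‖s i‖ ^ 2 := by
  have hm : (σ.card : ℝ) ≠ 0 := by exact_mod_cast hσ.card_pos.ne'
  simp only [dist_eq_norm, norm_sub_sq_real, Finset.sum_add_distrib, Finset.sum_sub_distrib,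
    Finset.sum_const, nsmul_eq_mul, inner_smul_right, inner_sum, ← Finset.mul_sum]
  field_simp

theorem norm_average_sq_lt {E ι : Type*} [NormedAddCommGroup E] [InnerProductSpace ℝ E] {s : ι → E}
    (hs : Function.Injective s) {σ : Finset ι} (hσ : 1 < σ.card) :
    ‖(σ.card : ℝ)⁻¹ • ∑ i ∈ σ, s i‖ ^ 2 < (σ.card : ℝ)⁻¹ * ∑ i ∈ σ, ‖s i‖ ^ 2 := by
  have hne : σ.Nonempty := Finset.card_pos.1 (by omega)
  have h := average_dist_sq s hne ((σ.card : ℝ)⁻¹ • ∑ i ∈ σ, s i)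
  rw [real_inner_self_eq_norm_sq] at h
  have hpos : 0 < (σ.card : ℝ)⁻¹ * ∑ i ∈ σ, dist ((σ.card : ℝ)⁻¹ • ∑ i ∈ σ, s i) (s i) ^ 2 := by
    have : (0 : ℝ) < σ.card := by exact_mod_cast hne.card_pos
    refine mul_pos (by positivity) (Finset.sum_pos' (fun i _ => by positivity) ?_)
    obtain ⟨i, hi, k, hk, hik⟩ := Finset.one_lt_card.1 hσ
    by_contra! hle
    have hz : ∀ i ∈ σ, (σ.card : ℝ)⁻¹ • ∑ i ∈ σ, s i = s i := fun i hi =>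
      dist_eq_zero.1 (pow_eq_zero_iff two_ne_zero |>.1 (le_antisymm (hle i hi) (sq_nonneg _)))
    exact hik (hs ((hz i hi).symm.trans (hz k hk)))
  linarith

theorem affineIndependent_nearestOf {d : ℕ} [Nontrivial (EuclideanSpace ℝ (Fin d))] {κ : Type*}
    [Finite κ] {y : κ → EuclideanSpace ℝ (Fin d)} (hy : GeneralPositionOn y Set.univ)
    {Y : Finset (EuclideanSpace ℝ (Fin d))} (hY : (Y : Set (EuclideanSpace ℝ (Fin d))) ⊆ Set.range y)
    (x : EuclideanSpace ℝ (Fin d)) :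
    AffineIndependent ℝ ((↑) : nearestOf Y x → EuclideanSpace ℝ (Fin d)) := by
  classical
  have := Fintype.ofFinite κ
  let T : Finset κ := Finset.univ.filter fun k => y k ∈ nearestOf Y x
  have hT : ∀ k ∈ T, y k ∈ nearestOf Y x := fun k hk => (Finset.mem_filter.1 hk).2
  have hr : ∃ r, ∀ k ∈ T, dist x (y k) = r := by
    rcases T.eq_empty_or_nonempty with h | ⟨l, hl⟩
    · exact ⟨0, by simp [h]⟩
    · exact ⟨dist x (y l), fun k hk =>
        le_antisymm ((hT k hk).2 _ (hT l hl).1) ((hT l hl).2 _ (hT k hk).1)⟩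
  obtain ⟨r, hr⟩ := hr
  have hind := (hy.1 T (Set.subset_univ _) (hy.2 T (Set.subset_univ _) x r hr)).range
  refine hind.mono fun q hq => ?_
  obtain ⟨k, rfl⟩ := hY hq.1
  exact ⟨⟨k, by simpa [T] using hq⟩, rfl⟩

end Configuration

section Existence

/-- The excess of the average squared distance to the vertices of `σ` over the squared distance to
the point of index `σ`, up to an error depending on the bound `M` on the norm of the argument. -/
noncomputable def centroidMargin {E ι κ : Type*} [NormedAddCommGroup E] [InnerProductSpace ℝ E]
    (M : ℝ) (σ : Finset ι) (y : Finset ι ⊕ κ → E) : ℝ :=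
  (σ.card : ℝ)⁻¹ * ∑ i ∈ σ, ‖y (Sum.inl {i})‖ ^ 2 - ‖y (Sum.inl σ)‖ ^ 2 -
    2 * M * ‖(σ.card : ℝ)⁻¹ • ∑ i ∈ σ, y (Sum.inl {i}) - y (Sum.inl σ)‖

theorem continuous_centroidMargin {E ι κ : Type*} [NormedAddCommGroup E] [InnerProductSpace ℝ E]
    (M : ℝ) (σ : Finset ι) : Continuous (centroidMargin (E := E) (κ := κ) M σ) := by
  unfold centroidMargin
  fun_prop

theorem dist_sq_add_centroidMargin_le {E ι κ : Type*} [NormedAddCommGroup E] [InnerProductSpace ℝ E]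
    {M : ℝ} {σ : Finset ι} (hσ : σ.Nonempty) (y : Finset ι ⊕ κ → E) {x : E} (hx : ‖x‖ ≤ M) :
    dist x (y (Sum.inl σ)) ^ 2 + centroidMargin M σ y ≤
      (σ.card : ℝ)⁻¹ * ∑ i ∈ σ, dist x (y (Sum.inl {i})) ^ 2 := by
  rw [average_dist_sq (fun i => y (Sum.inl {i})) hσ, centroidMargin, dist_eq_norm, norm_sub_sq_real]
  have h1 := (real_inner_le_norm x ((σ.card : ℝ)⁻¹ • ∑ i ∈ σ, y (Sum.inl {i}) - y (Sum.inl σ))).trans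
    (mul_le_mul_of_nonneg_right hx (norm_nonneg _))
  rw [inner_sub_right] at h1
  linarith

theorem average_lt_of_forall_lt {ι : Type*} {σ : Finset ι} (hσ : σ.Nonempty) {f : ι → ℝ} {a : ℝ}
    (h : ∀ i ∈ σ, f i < a) : (σ.card : ℝ)⁻¹ * ∑ i ∈ σ, f i < a := by
  have hm : (0 : ℝ) < σ.card := by exact_mod_cast hσ.card_pos
  rw [inv_mul_lt_iff₀ hm]
  calc ∑ i ∈ σ, f i < ∑ _i ∈ σ, a := Finset.sum_lt_sum_of_nonempty hσ h
    _ = σ.card * a := by simp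

open Filter Topology in
/-- The strict inequalities between distances which make `F` the nerve of the cells. -/
theorem exists_generalPosition_configuration (n : ℕ) {ι : Type*} [Fintype ι] {F : Set (Finset ι)}
    (hne : ∀ τ ∈ F, τ.Nonempty) (hcard : ∀ τ ∈ F, τ.card ≤ n + 1) :
    ∃ (M : ℝ) (y : Finset ι ⊕ (Fin (2 * n + 1) × Bool) → EuclideanSpace ℝ (Fin (2 * n + 1)))
      (p : Finset ι → EuclideanSpace ℝ (Fin (2 * n + 1))),
      GeneralPositionOn y Set.univ ∧ GeneralPositionOn p Set.univ ∧
      (∀ τ ∈ F, ∀ i ∈ τ, ∀ σ : Finset ι, σ.Nonempty → ¬ σ ⊆ τ →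
        dist (p τ) (y (Sum.inl {i})) < dist (p τ) (y (Sum.inl σ))) ∧
      (∀ τ ∈ F, ∀ i ∈ τ, ∀ q, dist (p τ) (y (Sum.inl {i})) < dist (p τ) (y (Sum.inr q))) ∧
      (∀ x i, (∀ q, dist x (y (Sum.inl {i})) ≤ dist x (y (Sum.inr q))) → ‖x‖ ≤ M) ∧
      ∀ σ : Finset ι, 1 < σ.card → 0 < centroidMargin M σ y := by
  obtain ⟨s, p₀, hs, hsp⟩ := exists_neighborly_family_of_fintype n ι
  obtain ⟨B, hB0, hB⟩ : ∃ B : ℝ, 0 ≤ B ∧ ∀ i, ‖s i‖ < B :=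
    ((eventually_ge_atTop 0).and (eventually_all.2 fun i => eventually_gt_atTop ‖s i‖)).exists
  obtain ⟨L, hL, hLp⟩ : ∃ L : ℝ, (2 * n + 1 : ℕ) * (B + 1) + 1 ≤ L ∧
      ∀ τ i, dist (p₀ τ) (s i) + ‖p₀ τ‖ < L :=
    ((eventually_ge_atTop _).and (eventually_all.2 fun τ => eventually_all.2 fun i =>
      eventually_gt_atTop _)).exists
  have hL0 : 0 ≤ L := le_trans (by positivity) hL
  let M : ℝ := (2 * n + 1 : ℕ) * L ^ 2 + (B + 1)
  let y₀ : Finset ι ⊕ (Fin (2 * n + 1) × Bool) → EuclideanSpace ℝ (Fin (2 * n + 1)) :=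
    Sum.elim (fun σ => (σ.card : ℝ)⁻¹ • ∑ i ∈ σ, s i) (framePoint L)
  have hy₀ : ∀ i, y₀ (Sum.inl {i}) = s i := fun i => by simp [y₀]
  have hev : ∀ᶠ c : (Finset ι ⊕ (Fin (2 * n + 1) × Bool) → EuclideanSpace ℝ (Fin (2 * n + 1))) ×
      (Finset ι → EuclideanSpace ℝ (Fin (2 * n + 1))) in 𝓝 (y₀, p₀),
      (∀ τ ∈ F, ∀ i ∈ τ, ∀ σ : Finset ι, σ.Nonempty → ¬ σ ⊆ τ →
        dist (c.2 τ) (c.1 (Sum.inl {i})) < dist (c.2 τ) (c.1 (Sum.inl σ))) ∧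
      (∀ τ ∈ F, ∀ i ∈ τ, ∀ q, dist (c.2 τ) (c.1 (Sum.inl {i})) < dist (c.2 τ) (c.1 (Sum.inr q))) ∧
      (∀ i, ‖c.1 (Sum.inl {i})‖ < B) ∧
      (∀ q, dist (c.1 (Sum.inr q)) (framePoint L q) < 1) ∧
      ∀ σ : Finset ι, 1 < σ.card → 0 < centroidMargin M σ c.1 := by
    simp only [eventually_and, eventually_all]
    refine ⟨fun τ hτ i hi σ hσ hστ => ?_, fun τ hτ i hi q => ?_, fun i => ?_, fun q => ?_,
      fun σ hσ => ?_⟩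
    · refine ContinuousAt.eventually_lt (by fun_prop) (by fun_prop) ?_
      dsimp only
      rw [hy₀]
      exact hsp τ (hne τ hτ) (hcard τ hτ) i hi σ hσ hστ
    · refine ContinuousAt.eventually_lt (by fun_prop) (by fun_prop) ?_
      dsimp only
      rw [hy₀]
      have h1 := norm_sub_norm_le (framePoint L q) (p₀ τ)
      rw [norm_framePoint hL0, ← dist_eq_norm, dist_comm] at h1
      have h2 := hLp τ i
      change _ < dist (p₀ τ) (framePoint L q)
      linarith
    · refine ContinuousAt.eventually_lt (by fun_prop) (by fun_prop) ?_
      dsimp only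
      rw [hy₀]
      exact hB i
    · refine ContinuousAt.eventually_lt (by fun_prop) (by fun_prop) ?_
      dsimp only
      simp [y₀]
    · have := continuous_centroidMargin (E := EuclideanSpace ℝ (Fin (2 * n + 1)))
        (κ := Fin (2 * n + 1) × Bool) M σ
      refine ContinuousAt.eventually_lt (by fun_prop) (by fun_prop) ?_
      have h1 := norm_average_sq_lt hs hσ
      simp only [centroidMargin, hy₀]
      simpa [y₀] using h1
  obtain ⟨ε, hε, hev⟩ := Metric.eventually_nhds_iff.1 hev
  obtain ⟨y, hy, hyg⟩ := exists_generalPositionOn_near y₀ hε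
  obtain ⟨p, hp, hpg⟩ := exists_generalPositionOn_near p₀ hε
  obtain ⟨h1, h2, h3, h4, h5⟩ := hev (y := (y, p)) (by
    rw [Prod.dist_eq, max_lt_iff, dist_pi_lt_iff hε, dist_pi_lt_iff hε]
    exact ⟨hy, hp⟩)
  refine ⟨M, y, p, hyg, hpg, h1, h2, fun x i hx => ?_, h5⟩
  refine norm_le_of_le_dist_framePoint (by positivity) hL x fun q => ?_
  have e1 := norm_sub_norm_le x (y (Sum.inl {i}))
  rw [← dist_eq_norm] at e1
  have e2 := dist_triangle x (y (Sum.inr q)) (framePoint L q)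
  have e2' := dist_triangle x (framePoint L q) (y (Sum.inr q))
  rw [dist_comm (framePoint L q)] at e2'
  have e3 := h3 i
  have e4 := h4 q
  have e5 := hx q
  dsimp only at e3 e4
  linarith

open Filter Topology in
/-- Every finite complex of dimension at most `n` is the nerve of cells of a simple Voronoi complex
in dimension `2n+1`. -/
theorem exists_isVoronoiNerve (n : ℕ) {ι : Type*} [Fintype ι] [DecidableEq ι]
    {F : Set (Finset ι)} (hne : ∀ τ ∈ F, τ.Nonempty) (hcard : ∀ τ ∈ F, τ.card ≤ n + 1)
    (hF : ∀ τ ∈ F, ∀ σ ⊆ τ, σ.Nonempty → σ ∈ F) (hF1 : ∀ i, {i} ∈ F) :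
    ∃ (s : ι → EuclideanSpace ℝ (Fin (2 * n + 1))) (p : Finset ι → EuclideanSpace ℝ (Fin (2 * n + 1)))
      (R : Finset (EuclideanSpace ℝ (Fin (2 * n + 1)))) (δ : ℝ), IsVoronoiNerve F s p R δ ∧
      (∀ T : Finset (Finset ι), T.card ≤ (n + 1) + (n + 1) →
        AffineIndependent ℝ fun τ : T => p τ) ∧
      ∀ Y : Finset (EuclideanSpace ℝ (Fin (2 * n + 1))),
        (Y : Set (EuclideanSpace ℝ (Fin (2 * n + 1)))) = Set.range s ∪ R →
        ∀ x, AffineIndependent ℝ ((↑) : nearestOf Y x → EuclideanSpace ℝ (Fin (2 * n + 1))) := by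
  classical
  obtain ⟨M, y, p, hy, hp, h1, h2, h3, h4⟩ := exists_generalPosition_configuration n hne hcard
  let R : Finset (EuclideanSpace ℝ (Fin (2 * n + 1))) :=
    (Finset.univ.filter fun σ : Finset ι => 1 < σ.card ∧ σ ∉ F).image (fun σ => y (Sum.inl σ)) ∪
      Finset.univ.image fun q => y (Sum.inr q)
  have hRl : ∀ σ : Finset ι, 1 < σ.card → σ ∉ F → y (Sum.inl σ) ∈ R := fun σ h h' =>
    Finset.mem_union_left _ (Finset.mem_image_of_mem _ (by simp [h, h']))
  have hRr : ∀ q, y (Sum.inr q) ∈ R := fun q =>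
    Finset.mem_union_right _ (Finset.mem_image_of_mem (fun q => y (Sum.inr q)) (Finset.mem_univ q))
  obtain ⟨δ, hδ, hδ1, hδ2⟩ : ∃ δ : ℝ, 0 < δ ∧
      (∀ τ ∈ F, ∀ i ∈ τ, ∀ k ∉ τ,
        δ ≤ dist (p τ) (y (Sum.inl {k})) ^ 2 - dist (p τ) (y (Sum.inl {i})) ^ 2) ∧
      ∀ σ : Finset ι, 1 < σ.card → δ ≤ centroidMargin M σ y := by
    have hle : ∀ c : ℝ, 0 < c → ∀ᶠ δ in 𝓝[>] (0 : ℝ), δ ≤ c := fun c hc =>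
      (eventually_le_nhds hc).filter_mono nhdsWithin_le_nhds
    refine Eventually.exists (f := 𝓝[>] (0 : ℝ)) ?_
    simp only [eventually_and, eventually_all]
    refine ⟨eventually_mem_nhdsWithin, fun τ hτ i hi k hk => hle _ ?_, fun σ hσ => hle _ (h4 σ hσ)⟩
    have := h1 τ hτ i hi {k} (Finset.singleton_nonempty k) (by simpa using hk)
    have := pow_lt_pow_left₀ this dist_nonneg two_ne_zero
    linarith
  refine ⟨fun i => y (Sum.inl {i}), p, R, δ, ⟨hδ, hF, ?_, ?_, ?_⟩, ?_, ?_⟩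
  · intro τ hτ i hi r hr
    rcases Finset.mem_union.1 hr with hr | hr
    · obtain ⟨σ, hσ, rfl⟩ := Finset.mem_image.1 hr
      obtain ⟨hσ1, hσF⟩ := (Finset.mem_filter.1 hσ).2
      have hσne : σ.Nonempty := Finset.card_pos.1 (by omega)
      exact (h1 τ hτ i hi σ hσne fun h => hσF (hF τ hτ σ h hσne)).le
    · obtain ⟨q, _, rfl⟩ := Finset.mem_image.1 hr
      exact (h2 τ hτ i hi q).le
  · intro τ hτ i hi k hk
    have := hδ1 τ hτ i hi k hk
    linarith
  · intro x i hx σ hσ hnear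
    by_contra hσF
    have hσ1 : 1 < σ.card := by
      by_contra! h
      obtain ⟨k, rfl⟩ := Finset.card_eq_one.1 (le_antisymm h hσ.card_pos)
      exact hσF (hF1 k)
    have hxM := h3 x i fun q => hx _ (hRr q)
    have e1 := dist_sq_add_centroidMargin_le hσ y hxM
    have e2 := average_lt_of_forall_lt hσ hnear
    have e3 := pow_le_pow_left₀ dist_nonneg (hx _ (hRl σ hσ1 hσF)) 2
    have e4 := hδ2 σ hσ1
    linarith
  · intro T hT
    exact hp.1 T (Set.subset_univ _) (by rw [finrank_euclideanSpace_fin]; omega)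
  · intro Y hY x
    refine affineIndependent_nearestOf hy ?_ x
    rw [hY]
    rintro _ (⟨i, rfl⟩ | hr)
    · exact ⟨_, rfl⟩
    · rcases Finset.mem_union.1 hr with hr | hr
      · obtain ⟨σ, _, rfl⟩ := Finset.mem_image.1 hr
        exact ⟨_, rfl⟩
      · obtain ⟨q, _, rfl⟩ := Finset.mem_image.1 hr
        exact ⟨_, rfl⟩

end Existence

theorem voronoiUnion_eq_cellUnion {d : ℕ} {ι : Type*} [Fintype ι]
    {s : ι → EuclideanSpace ℝ (Fin d)} {Y S R : Finset (EuclideanSpace ℝ (Fin d))}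
    (hS : (S : Set (EuclideanSpace ℝ (Fin d))) = Set.range s)
    (hY : (Y : Set (EuclideanSpace ℝ (Fin d))) = Set.range s ∪ R) :
    voronoiUnion Y S = cellUnion s (R : Set (EuclideanSpace ℝ (Fin d))) := by
  have hS' : ∀ q, q ∈ S ↔ q ∈ Set.range s := fun q => by rw [← hS, Finset.mem_coe]
  have hY' : ∀ q, q ∈ Y ↔ q ∈ Set.range s ∨ q ∈ R := fun q => by
    rw [← Finset.mem_coe, hY, Set.mem_union, Finset.mem_coe]
  ext x
  constructor
  · rintro ⟨q, hq, hx⟩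
    obtain ⟨i, rfl⟩ := (hS' q).1 hq
    exact ⟨i, fun r hr => hx r ((hY' r).2 (Or.inr hr))⟩
  · rintro ⟨i, hi⟩
    have : Nonempty ι := ⟨i⟩
    obtain ⟨l, _, hl⟩ := exists_infDist_eq_dist_range s x
    refine ⟨s l, (hS' _).2 ⟨l, rfl⟩, fun q hq => ?_⟩
    rcases (hY' q).1 hq with ⟨k, rfl⟩ | hr
    · exact hl k
    · exact (hl i).trans (hi q hr)

/-- Every finite simplicial complex of dimension at most `n` embeds in `ℝ^{2n+1}` in such a
way that its image is contained in, and is a deformation (up to homotopy equivalence) of, a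
union of Voronoi cells of a simple Voronoi complex. -/
theorem simplicialComplex_homotopyEquiv_voronoi_subcomplex
    (n : ℕ) (hn : 1 ≤ n) (m : ℕ)
    (K : SimplicialComplex ℝ (EuclideanSpace ℝ (Fin m)))
    (hfin : K.faces.Finite)
    (hdim : ∀ s ∈ K.faces, s.card ≤ n + 1) :
    ∃ (Y S : Finset (EuclideanSpace ℝ (Fin (2 * n + 1)))), S ⊆ Y ∧
      -- the Voronoi complex of `Y` is simple
      (∀ x : EuclideanSpace ℝ (Fin (2 * n + 1)),
        AffineIndependent ℝ ((↑) : nearestOf Y x → EuclideanSpace ℝ (Fin (2 * n + 1)))) ∧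
      -- a topological embedding `j` of the underlying space of `K` into `ℝ^{2n+1}`
      ∃ j : C(K.space, EuclideanSpace ℝ (Fin (2 * n + 1))),
        Topology.IsEmbedding j ∧
        -- whose image lies in the union `U` of the Voronoi cells of the points of `S`,
        ∃ hsub : Set.range j ⊆ voronoiUnion Y S,
          -- such that the inclusion of the image into `U` is a homotopy equivalence
          ∃ g : C(voronoiUnion Y S, Set.range j),
            ((⟨Set.inclusion hsub, continuous_inclusion hsub⟩ :
                C(Set.range j, voronoiUnion Y S)).comp g).Homotopic
              (ContinuousMap.id _) ∧
            (g.comp ⟨Set.inclusion hsub, continuous_inclusion hsub⟩).Homotopic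
              (ContinuousMap.id _) := by
  classical
  have hv : K.vertices.Finite := by
    rw [SimplicialComplex.vertices_eq]
    exact hfin.biUnion fun k _ => k.finite_toSet
  have : Fintype K.vertices := hv.fintype
  have hF : ∀ τ ∈ K.vertexFaces, ∀ σ ⊆ τ, σ.Nonempty → σ ∈ K.vertexFaces := fun τ hτ σ hσ hne =>
    K.down_closed hτ (Finset.map_subset_map.2 hσ) hne.map
  have hcard : ∀ τ ∈ K.vertexFaces, τ.card ≤ n + 1 := fun τ hτ => by
    simpa using hdim _ hτ
  obtain ⟨s, p, R, δ, hN, hp, hY⟩ := exists_isVoronoiNerve n (F := K.vertexFaces)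
    (fun τ hτ => Finset.map_nonempty.1 (SimplicialComplex.nonempty_of_mem_faces hτ)) hcard hF
    (fun i => by
      change Finset.map _ _ ∈ K.faces
      rw [Finset.map_singleton]
      exact i.2)
  let S := Finset.univ.image s
  have hS : (S : Set (EuclideanSpace ℝ (Fin (2 * n + 1)))) = Set.range s := by simp [S]
  have hSR : ((S ∪ R : Finset _) : Set (EuclideanSpace ℝ (Fin (2 * n + 1)))) = Set.range s ∪ R := by
    rw [Finset.coe_union, hS]
  refine ⟨S ∪ R, S, Finset.subset_union_left, hY _ hSR, ?_⟩
  rw [voronoiUnion_eq_cellUnion hS hSR]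
  obtain ⟨f, g, hf, hfg, hgf⟩ := hN.exists_homotopyEquiv
  obtain ⟨h⟩ := K.nonempty_homeomorph_barycentricRealization
  have : CompactSpace (barycentricRealization K.vertexFaces) :=
    isCompact_iff_compactSpace.1 (isCompact_barycentricRealization _)
  refine exists_embedding_of_homotopyEquiv h f g (fun z z' hz => Subtype.ext ?_) hfg hgf
  refine layerMap_injOn hF hcard hp z.2 z'.2 ?_
  rw [← hf, ← hf, hz]
end

section
/- The group SL(2, ℤ) of 2×2 integer matrices of determinant 1 is ℚ-superperfect: H₁(SL(2,ℤ), ℚ) = 0 and H₂(SL(2,ℤ), ℚ) = 0, where homology is taken with coefficients in the trivial representation ℚ. -/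
/-- The differential `Cₙ₊₁ → Cₙ` of the complex of inhomogeneous chains of a group `G` with
coefficients in the trivial `G`-representation `ℚ`, where `Cₙ = (Gⁿ →₀ ℚ)` is the free
`ℚ`-module on `n`-tuples of elements of `G`.  On a generator `[g₁|⋯|gₙ₊₁]` it is given by
`[g₂|⋯|gₙ₊₁] + ∑ᵢ (-1)ⁱ [g₁|⋯|gᵢgᵢ₊₁|⋯|gₙ₊₁] + (-1)ⁿ⁺¹ [g₁|⋯|gₙ]` (the first term uses that
the `G`-action on `ℚ` is trivial). -/
noncomputable def inhomogeneousChainsD (G : Type*) [Group G] (n : ℕ) :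
    ((Fin (n + 1) → G) →₀ ℚ) →ₗ[ℚ] ((Fin n → G) →₀ ℚ) :=
  Finsupp.lift ((Fin n → G) →₀ ℚ) ℚ (Fin (n + 1) → G) fun g =>
    Finsupp.single (fun i => g i.succ) (1 : ℚ) +
      ∑ j : Fin (n + 1),
        ((-1 : ℚ) ^ ((j : ℕ) + 1)) • Finsupp.single (Fin.contractNth j (· * ·) g) (1 : ℚ)

/-- The first group homology `H₁(G, ℚ)` of `G` with coefficients in the trivial
`G`-representation `ℚ`: the quotient of the `1`-cycles by the `1`-boundaries. -/
noncomputable def groupHomology1 (G : Type*) [Group G] : Type _ :=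
  ↥(LinearMap.ker (inhomogeneousChainsD G 0)) ⧸
    Submodule.comap (LinearMap.ker (inhomogeneousChainsD G 0)).subtype
      (LinearMap.range (inhomogeneousChainsD G 1))

/-- The second group homology `H₂(G, ℚ)` of `G` with coefficients in the trivial
`G`-representation `ℚ`: the quotient of the `2`-cycles by the `2`-boundaries. -/
noncomputable def groupHomology2 (G : Type*) [Group G] : Type _ :=
  ↥(LinearMap.ker (inhomogeneousChainsD G 1)) ⧸
    Submodule.comap (LinearMap.ker (inhomogeneousChainsD G 1)).subtype
      (LinearMap.range (inhomogeneousChainsD G 2))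


section Duality

variable {G : Type*} [Group G]

/-- Over a field, a complex `M →d N →e P` is exact at `N` as soon as every functional on `N` that
vanishes on the image of `d` factors through `e`. -/
lemma LinearMap.ker_le_range_of_forall_exists_comp {K M N P : Type*} [Field K]
    [AddCommGroup M] [Module K M] [AddCommGroup N] [Module K N] [AddCommGroup P] [Module K P]
    (d : M →ₗ[K] N) (e : N →ₗ[K] P)
    (h : ∀ φ : N →ₗ[K] K, φ ∘ₗ d = 0 → ∃ ψ : P →ₗ[K] K, φ = ψ ∘ₗ e) :
    LinearMap.ker e ≤ LinearMap.range d := by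
  intro x hx
  by_contra hxd
  obtain ⟨φ, hφx, hφ⟩ := Submodule.exists_le_ker_of_notMem hxd
  obtain ⟨ψ, rfl⟩ := h φ (LinearMap.range_le_ker_iff.mp hφ)
  exact hφx (by simp [LinearMap.mem_ker.mp hx])

lemma Submodule.subsingleton_quotient_comap_subtype {R M : Type*} [Ring R] [AddCommGroup M]
    [Module R M] {p q : Submodule R M} (h : p ≤ q) :
    Subsingleton (p ⧸ q.comap p.subtype) := by
  rw [Submodule.Quotient.subsingleton_iff, Submodule.comap_subtype_eq_top]
  exact h

lemma inhomogeneousChainsD_one_single (a b : G) :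
    inhomogeneousChainsD G 1 (Finsupp.single ![a, b] 1) =
      Finsupp.single ![b] 1 - Finsupp.single ![a * b] 1 + Finsupp.single ![a] 1 := by
  have h₀ : (fun _ : Fin 1 => b) = ![b] := by
    ext i; fin_cases i; rfl
  have h₁ : Fin.contractNth (0 : Fin 2) (· * ·) ![a, b] = ![a * b] := by
    ext i; fin_cases i; rfl
  have h₂ : Fin.contractNth (1 : Fin 2) (· * ·) ![a, b] = ![a] := by
    ext i; fin_cases i; rfl
  simp [inhomogeneousChainsD, Fin.sum_univ_two, h₀, h₁, h₂, sub_eq_add_neg, add_assoc]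

lemma inhomogeneousChainsD_two_single (a b c : G) :
    inhomogeneousChainsD G 2 (Finsupp.single ![a, b, c] 1) =
      Finsupp.single ![b, c] 1 - Finsupp.single ![a * b, c] 1 +
        Finsupp.single ![a, b * c] 1 - Finsupp.single ![a, b] 1 := by
  have h₁ : Fin.contractNth (0 : Fin 3) (· * ·) ![a, b, c] = ![a * b, c] := by
    ext i; fin_cases i <;> rfl
  have h₂ : Fin.contractNth (1 : Fin 3) (· * ·) ![a, b, c] = ![a, b * c] := by
    ext i; fin_cases i <;> rfl
  have h₃ : Fin.contractNth (2 : Fin 3) (· * ·) ![a, b, c] = ![a, b] := by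
    ext i; fin_cases i <;> rfl
  simp [inhomogeneousChainsD, Fin.sum_univ_three, h₁, h₂, h₃, pow_succ]
  abel

lemma groupHomology1_subsingleton
    (h : ∀ f : G → ℚ, (∀ a b, f (a * b) = f a + f b) → ∀ a, f a = 0) :
    Subsingleton (groupHomology1 G) := by
  refine Submodule.subsingleton_quotient_comap_subtype
    (LinearMap.ker_le_range_of_forall_exists_comp _ _ fun φ hφ => ⟨0, ?_⟩)
  have key := h (fun a => φ (Finsupp.single ![a] 1)) fun a b => by
    have : φ (inhomogeneousChainsD G 1 (Finsupp.single ![a, b] 1)) = 0 :=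
      LinearMap.congr_fun hφ _
    rw [inhomogeneousChainsD_one_single, map_add, map_sub] at this
    linarith
  refine Finsupp.lhom_ext' fun v => LinearMap.ext_ring ?_
  have hv : v = ![v 0] := by ext i; fin_cases i; rfl
  rw [hv]
  simpa using key (v 0)

lemma groupHomology2_subsingleton
    (h : ∀ f : G → G → ℚ, (∀ a b c, f b c + f a (b * c) = f (a * b) c + f a b) →
      ∃ p : G → ℚ, ∀ a b, f a b = p a + p b - p (a * b)) :
    Subsingleton (groupHomology2 G) := by
  refine Submodule.subsingleton_quotient_comap_subtype
    (LinearMap.ker_le_range_of_forall_exists_comp _ _ fun φ hφ => ?_)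
  obtain ⟨p, hp⟩ := h (fun a b => φ (Finsupp.single ![a, b] 1)) fun a b c => by
    have : φ (inhomogeneousChainsD G 2 (Finsupp.single ![a, b, c] 1)) = 0 :=
      LinearMap.congr_fun hφ _
    rw [inhomogeneousChainsD_two_single, map_sub, map_add, map_sub] at this
    linarith
  refine ⟨Finsupp.lift ℚ ℚ (Fin 1 → G) fun v => p (v 0),
    Finsupp.lhom_ext' fun v => LinearMap.ext_ring ?_⟩
  have hv : v = ![v 0, v 1] := by ext i; fin_cases i <;> rfl
  rw [hv]
  simp only [LinearMap.comp_apply, Finsupp.lsingle_apply, inhomogeneousChainsD_one_single, hp,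
    map_add, map_sub]
  simp
  ring

end Duality

section CocycleExtension

/-- The underlying set of the central extension of `G` by `ℚ` attached to a `2`-cocycle `f`. -/
@[ext]
structure CocycleExtension {G : Type*} (f : G → G → ℚ) where
  /-- The coordinate in the kernel. -/
  fst : ℚ
  /-- The projection to `G`. -/
  snd : G

variable {G : Type*} [Group G] {f : G → G → ℚ}

/-- The group structure `(x, a) * (y, b) = (x + y + f a b, a * b)` on `CocycleExtension f`. -/
abbrev CocycleExtension.group (hf : ∀ a b c, f b c + f a (b * c) = f (a * b) c + f a b) :
    Group (CocycleExtension f) :=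
  letI : Mul (CocycleExtension f) := ⟨fun x y => ⟨x.fst + y.fst + f x.snd y.snd, x.snd * y.snd⟩⟩
  letI : One (CocycleExtension f) := ⟨⟨-f 1 1, 1⟩⟩
  letI : Inv (CocycleExtension f) := ⟨fun x => ⟨-x.fst - f x.snd⁻¹ x.snd - f 1 1, x.snd⁻¹⟩⟩
  Group.ofLeftAxioms
    (fun x y z => by
      refine CocycleExtension.ext ?_ (mul_assoc _ _ _)
      change x.fst + y.fst + f x.snd y.snd + z.fst + f (x.snd * y.snd) z.snd =
        x.fst + (y.fst + z.fst + f y.snd z.snd) + f x.snd (y.snd * z.snd)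
      linarith [hf x.snd y.snd z.snd])
    (fun x => by
      refine CocycleExtension.ext ?_ (one_mul _)
      change -f 1 1 + x.fst + f 1 x.snd = x.fst
      have := hf 1 1 x.snd
      simp only [one_mul] at this
      linarith)
    (fun x => by
      refine CocycleExtension.ext ?_ (inv_mul_cancel _)
      change -x.fst - f x.snd⁻¹ x.snd - f 1 1 + x.fst + f x.snd⁻¹ x.snd = -f 1 1
      ring)

end CocycleExtension

namespace Matrix.SpecialLinearGroup

open ModularGroup

/-- `SL(2, ℤ)` is generated by `S` and `S * T`. -/
lemma SL2Z_closure_S_ST : Subgroup.closure {S, S * T} = ⊤ := by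
  rw [eq_top_iff, ← _root_.SpecialLinearGroup.SL2Z_generators, Subgroup.closure_le]
  have hS : S ∈ Subgroup.closure {S, S * T} := Subgroup.subset_closure (by simp)
  have hST : S * T ∈ Subgroup.closure {S, S * T} := Subgroup.subset_closure (by simp)
  rintro x (rfl | rfl)
  · exact hS
  · simpa using mul_mem (inv_mem hS) hST

lemma SL2Z_additive_eq_zero (f : SpecialLinearGroup (Fin 2) ℤ → ℚ)
    (hf : ∀ a b, f (a * b) = f a + f b) (a : SpecialLinearGroup (Fin 2) ℤ) : f a = 0 := by
  let F : SpecialLinearGroup (Fin 2) ℤ →* Multiplicative ℚ :=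
    MonoidHom.mk' (fun a => Multiplicative.ofAdd (f a)) fun a b => by rw [hf]; rfl
  have h1 : f 1 = 0 := by simpa using hf 1 1
  have hS : f S = 0 := by
    have h : f (S * S * (S * S)) = 0 := by
      rw [show S * S * (S * S) = 1 by decide, h1]
    simp only [hf] at h
    linarith
  have hST : f (S * T) = 0 := by
    have h : f ((S * T) * (S * T) * (S * T)) = f (S * S) :=
      congrArg f (by decide)
    rw [hf, hf, hf S S, hS] at h
    linarith
  have hF : F = 1 := by
    refine MonoidHom.eq_of_eqOn_dense SL2Z_closure_S_ST ?_
    rintro x (rfl | rfl)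
    · exact congrArg Multiplicative.ofAdd hS
    · exact congrArg Multiplicative.ofAdd hST
  exact congrArg Multiplicative.toAdd (DFunLike.congr_fun hF a)

section NormalForm

variable {E : Type*} [Group E] {s u : E}

/-- Elements generated by `s` and `u` with `s ^ 4 = 1` and `u ^ 3 = s ^ 2` have the form
`u ^ a * w * s ^ b` with `w` a positive word in `s ^ 3 * u` and `s ^ 3 * u ^ 2`. -/
lemma exists_normalForm (hs : s ^ 4 = 1) (hu : u ^ 3 = s ^ 2) {x : E}
    (hx : x ∈ Subgroup.closure {s, u}) :
    ∃ a < 3, ∃ b < 4, ∃ w ∈ Submonoid.closure {s ^ 3 * u, s ^ 3 * u ^ 2},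
      x = u ^ a * w * s ^ b := by
  set M := Submonoid.closure {s ^ 3 * u, s ^ 3 * u ^ 2}
  have hsu : Commute (s ^ 2) u := hu ▸ (Commute.refl u).pow_left 3
  have hss : Commute (s ^ 2) s := (Commute.refl s).pow_left 2
  have hsM : ∀ w ∈ M, Commute (s ^ 2) w := by
    intro w hw
    induction hw using Submonoid.closure_induction with
    | mem x hx =>
      rcases hx with rfl | rfl
      · exact (hss.pow_right 3).mul_right hsu
      · exact (hss.pow_right 3).mul_right (hsu.pow_right 2)
    | one => exact Commute.one_right _
    | mul x y _ _ hx hy => exact hx.mul_right hy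
  have reduce : ∀ a < 3, ∀ b, ∀ w ∈ M,
      ∃ a' < 3, ∃ b' < 4, ∃ w' ∈ M, u ^ a * w * s ^ b = u ^ a' * w' * s ^ b' :=
    fun a ha b w hw => ⟨a, ha, b % 4, Nat.mod_lt _ (by norm_num), w, hw, by
      rw [← pow_eq_pow_mod b hs]⟩
  have hmul_u : ∀ y, (∃ a < 3, ∃ b < 4, ∃ w ∈ M, y = u ^ a * w * s ^ b) →
      ∃ a < 3, ∃ b < 4, ∃ w ∈ M, u * y = u ^ a * w * s ^ b := by
    rintro y ⟨a, ha, b, hb, w, hw, rfl⟩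
    obtain ha | rfl : a < 2 ∨ a = 2 := by omega
    · have h := reduce (a + 1) (by omega) b w hw
      simpa only [pow_succ', mul_assoc] using h
    · have h := reduce 0 (by omega) (2 + b) w hw
      have e : u * (u ^ 2 * w * s ^ b) = u ^ 0 * w * s ^ (2 + b) := by
        calc u * (u ^ 2 * w * s ^ b) = u ^ 3 * w * s ^ b := by group
          _ = w * s ^ 2 * s ^ b := by rw [hu, (hsM w hw).eq]
          _ = _ := by rw [pow_zero, one_mul, mul_assoc, ← pow_add]
      rwa [e]
  have hmul_s : ∀ y, (∃ a < 3, ∃ b < 4, ∃ w ∈ M, y = u ^ a * w * s ^ b) →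
      ∃ a < 3, ∃ b < 4, ∃ w ∈ M, s * y = u ^ a * w * s ^ b := by
    have hword : ∀ v, s ^ 3 * v ∈ M → ∀ w ∈ M, ∀ b, s * (v * w * s ^ b) =
        u ^ 0 * (s ^ 3 * v * w) * s ^ (2 + b) := by
      intro v hv w hw b
      calc s * (v * w * s ^ b) = s ^ 4 * (s * (v * w * s ^ b)) := by rw [hs, one_mul]
        _ = s ^ 2 * (s ^ 3 * v * w) * s ^ b := by group
        _ = _ := by
          rw [(hsM _ (mul_mem hv hw)).eq, pow_zero, one_mul, mul_assoc _ (s ^ 2), ← pow_add]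
    rintro y ⟨a, ha, b, hb, w, hw, rfl⟩
    obtain rfl | rfl | rfl : a = 0 ∨ a = 1 ∨ a = 2 := by omega
    · induction hw using Submonoid.closure_induction_left with
      | one =>
        have h := reduce 0 (by omega) (b + 1) 1 (one_mem M)
        simpa [pow_succ'] using h
      | mul_left x hx w hw _ =>
        have key : ∀ a < 3, s * (u ^ 0 * (s ^ 3 * u ^ a * w) * s ^ b) = u ^ a * w * s ^ b := by
          intro a _
          calc _ = s ^ 4 * (u ^ a * w * s ^ b) := by group
            _ = _ := by rw [hs, one_mul]
        rcases hx with rfl | rfl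
        · have := key 1 (by omega)
          rw [pow_one] at this
          rw [this, ← pow_one u]
          exact ⟨1, by omega, b, hb, w, hw, by simp⟩
        · rw [key 2 (by omega)]
          exact ⟨2, by omega, b, hb, w, hw, rfl⟩
    · have hm : s ^ 3 * u ^ 1 ∈ M := Submonoid.subset_closure (by simp)
      rw [hword _ hm w hw]
      exact reduce 0 (by omega) _ _ (mul_mem hm hw)
    · have hm : s ^ 3 * u ^ 2 ∈ M := Submonoid.subset_closure (by simp)
      rw [hword _ hm w hw]
      exact reduce 0 (by omega) _ _ (mul_mem hm hw)
  induction hx using Subgroup.closure_induction_left with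
  | one => exact ⟨0, by omega, 0, by omega, 1, one_mem M, by simp⟩
  | mul_left x hx y _ ih =>
    rcases hx with rfl | rfl
    · exact hmul_s y ih
    · exact hmul_u y ih
  | inv_mul_cancel x hx y _ ih =>
    rcases hx with rfl | rfl
    · have : x⁻¹ * y = x * (x * (x * y)) := by
        rw [inv_mul_eq_iff_eq_mul]
        calc y = x ^ 4 * y := by rw [hs, one_mul]
          _ = _ := by simp only [pow_succ, pow_zero, one_mul, mul_assoc]
      rw [this]
      exact hmul_s _ (hmul_s _ (hmul_s _ ih))
    · have : x⁻¹ * y = x * (x * (x * (x * (x * y)))) := by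
        rw [inv_mul_eq_iff_eq_mul]
        calc y = s ^ 4 * y := by rw [hs, one_mul]
          _ = (s ^ 2) ^ 2 * y := by rw [← pow_mul]
          _ = (x ^ 3) ^ 2 * y := by rw [hu]
          _ = _ := by simp only [pow_succ, pow_zero, one_mul, mul_assoc]
      rw [this]
      exact hmul_u _ (hmul_u _ (hmul_u _ (hmul_u _ (hmul_u _ ih))))

variable (π : E →* SpecialLinearGroup (Fin 2) ℤ)

/-- Nonempty positive words in lifts of `T` and its transpose have nonnegative entries with sum
at least `3`. -/
lemma positive_word (hS : π s = S) (hU : π u = S * T) {w : E}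
    (hw : w ∈ Submonoid.closure {s ^ 3 * u, s ^ 3 * u ^ 2}) :
    w = 1 ∨ (0 ≤ π w 0 0 ∧ 0 ≤ π w 0 1 ∧ 0 ≤ π w 1 0 ∧ 0 ≤ π w 1 1 ∧
      3 ≤ π w 0 0 + π w 0 1 + π w 1 0 + π w 1 1) := by
  have h₁ : (π (s ^ 3 * u) : Matrix (Fin 2) (Fin 2) ℤ) = !![1, 1; 0, 1] := by
    rw [map_mul, map_pow, hS, hU]; decide
  have h₂ : (π (s ^ 3 * u ^ 2) : Matrix (Fin 2) (Fin 2) ℤ) = !![1, 0; 1, 1] := by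
    rw [map_mul, map_pow, map_pow, hS, hU]; decide
  induction hw using Submonoid.closure_induction_left with
  | one => exact Or.inl rfl
  | mul_left x hx w _ ih =>
    right
    rw [map_mul, coe_mul]
    rcases hx with rfl | rfl
    · rw [h₁]
      rcases ih with rfl | ih
      · simp [Matrix.mul_apply]
      · simp [Matrix.mul_apply]
        omega
    · rw [h₂]
      rcases ih with rfl | ih
      · simp [Matrix.mul_apply]
      · simp [Matrix.mul_apply]
        omega

lemma eq_one_of_mem_closure (hs : s ^ 4 = 1) (hu : u ^ 3 = s ^ 2) (hS : π s = S)
    (hU : π u = S * T) {x : E} (hx : x ∈ Subgroup.closure {s, u}) (hπ : π x = 1) : x = 1 := by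
  obtain ⟨a, ha, b, hb, w, hw, rfl⟩ := exists_normalForm hs hu hx
  rw [map_mul, map_mul, map_pow, map_pow, hS, hU] at hπ
  rcases positive_word π hS hU hw with rfl | h
  · rw [map_one] at hπ
    have : a = 0 ∧ b = 0 := by
      clear hx
      revert a b
      decide
    simp [this]
  · exfalso
    generalize π w = W at h hπ
    have hW : W = ((S * T) ^ a)⁻¹ * (S ^ b)⁻¹ := by
      rw [eq_inv_mul_iff_mul_eq, eq_inv_iff_mul_eq_one, hπ]
    subst hW
    clear hπ hw hx
    revert a b
    decide

/-- A group over `SL(2, ℤ)` containing lifts of `S` and `S * T` that satisfy the relations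
`s ^ 4 = 1` and `u ^ 3 = s ^ 2` splits. -/
lemma exists_section (hs : s ^ 4 = 1) (hu : u ^ 3 = s ^ 2) (hS : π s = S) (hU : π u = S * T) :
    ∃ σ : SpecialLinearGroup (Fin 2) ℤ →* E, ∀ g, π (σ g) = g := by
  let H := Subgroup.closure {s, u}
  have hinj : Function.Injective (π.comp H.subtype) := by
    rw [injective_iff_map_eq_one]
    rintro ⟨x, hx⟩ h
    exact Subtype.ext (eq_one_of_mem_closure π hs hu hS hU hx h)
  have hsurj : Function.Surjective (π.comp H.subtype) := by
    rw [← MonoidHom.range_eq_top, MonoidHom.range_comp, Subgroup.range_subtype,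
      MonoidHom.map_closure, Set.image_pair, hS, hU, SL2Z_closure_S_ST]
  let e := MulEquiv.ofBijective _ ⟨hinj, hsurj⟩
  exact ⟨H.subtype.comp e.symm.toMonoidHom, fun g => e.apply_symm_apply g⟩

end NormalForm

/-- Every rational `2`-cocycle on `SL(2, ℤ)` is a coboundary. -/
lemma SL2Z_exists_primitive
    (f : SpecialLinearGroup (Fin 2) ℤ → SpecialLinearGroup (Fin 2) ℤ → ℚ)
    (hf : ∀ a b c, f b c + f a (b * c) = f (a * b) c + f a b) :
    ∃ p : SpecialLinearGroup (Fin 2) ℤ → ℚ, ∀ a b, f a b = p a + p b - p (a * b) := by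
  let := CocycleExtension.group hf
  have hmul (x y : CocycleExtension f) :
      x * y = ⟨x.fst + y.fst + f x.snd y.snd, x.snd * y.snd⟩ := rfl
  have hone : (1 : CocycleExtension f) = ⟨-f 1 1, 1⟩ := rfl
  let π : CocycleExtension f →* SpecialLinearGroup (Fin 2) ℤ :=
    MonoidHom.mk' CocycleExtension.snd fun _ _ => rfl
  have hlift₁ : ∃ s, s ^ 4 = 1 ∧ π s = S := by
    refine ⟨⟨-(f S S + f (S * S) S + f (S * S * S) S + f 1 1) / 4, S⟩, ?_, rfl⟩
    simp only [pow_succ, pow_zero, one_mul]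
    refine CocycleExtension.ext ?_ ?_
    · simp only [hmul, hone]
      ring
    · change S * S * S * S = 1
      decide
  obtain ⟨s, hs, hS⟩ := hlift₁
  have hlift₂ : ∃ u, u ^ 3 = s ^ 2 ∧ π u = S * T := by
    refine ⟨⟨((s ^ 2).fst - f (S * T) (S * T) - f (S * T * (S * T)) (S * T)) / 3, S * T⟩, ?_, rfl⟩
    refine CocycleExtension.ext ?_ ?_
    · simp only [pow_succ _ 2, pow_two (M := CocycleExtension f) ⟨_, S * T⟩, hmul ⟨_, S * T⟩,
        hmul ⟨_, S * T * (S * T)⟩]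
      ring
    · change π (_ ^ 3) = π (s ^ 2)
      rw [map_pow, map_pow, hS]
      change (S * T) ^ 3 = S ^ 2
      decide
  obtain ⟨u, hu, hU⟩ := hlift₂
  obtain ⟨σ, hσ⟩ := exists_section π hs hu hS hU
  refine ⟨fun g => -(σ g).fst, fun a b => ?_⟩
  have h := congrArg CocycleExtension.fst (map_mul σ a b)
  rw [hmul] at h
  have ha : (σ a).snd = a := hσ a
  have hb : (σ b).snd = b := hσ b
  simp only [ha, hb] at h
  linarith

end Matrix.SpecialLinearGroup

/-- `SL(2, ℤ)` is `ℚ`-superperfect: `H₁(SL(2,ℤ), ℚ) = 0` and `H₂(SL(2,ℤ), ℚ) = 0`. -/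
theorem sl2z_qSuperperfect :
    Subsingleton (groupHomology1 (Matrix.SpecialLinearGroup (Fin 2) ℤ)) ∧
      Subsingleton (groupHomology2 (Matrix.SpecialLinearGroup (Fin 2) ℤ)) := by
  constructor
  · exact groupHomology1_subsingleton fun f hf =>
      Matrix.SpecialLinearGroup.SL2Z_additive_eq_zero f hf
  · exact groupHomology2_subsingleton fun f hf =>
      Matrix.SpecialLinearGroup.SL2Z_exists_primitive f hf
end
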